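/- arXiv:1812.10123 — 3 statements merged into one kernel-verified Lean document; each statement's English description precedes it below -/
import Mathlib

section
/- Let Δ ⊂ ℝ^d be a lattice simplex of dimension d with vertices v_1, …, v_{d+1} ∈ ℤ^d, let k ≥ 3 be an integer, and for each integer i set h_i = #{α ∈ Λ_Δ : ht(α) = i}. Assume h_{k+1} = h_{k+2} = ⋯ = h_{2k} = 0, i.e., no α ∈ Λ_Δ satisfies k+1 ≤ ht(α) ≤ 2k. Then there is a subset S ⊆ {1,…,d+1} such that the face Δ' = conv{v_i : i ∈ S} of Δ, of dimension m = #S − 1, satisfies #(nΔ' ∩ ℤ^d) = Σ_{i=0}^{k} h_i · C(n+m−i, m) for every integer n ≥ 1; that is, the h*-polynomial of Δ' equals Σ_{i=0}^{k} h_i t^i. -/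
open scoped Pointwise

/-- The coercion of an integer point to a real point. -/
def toReal {d : ℕ} (x : Fin d → ℤ) : Fin d → ℝ := fun i => (x i : ℝ)

/-- The number of lattice points in the `n`-th dilation of `P ⊆ ℝ^d`. -/
noncomputable def latticeCount {d : ℕ} (P : Set (Fin d → ℝ)) (n : ℕ) : ℕ :=
  Set.ncard {x : Fin d → ℤ | toReal x ∈ (n : ℝ) • P}

/-- The finite abelian group `Λ_Δ` attached to a lattice simplex with vertices `v`. -/
def Lambda {d : ℕ} (v : Fin (d + 1) → Fin d → ℤ) : Set (Fin (d + 1) → ℝ) :=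
  {r | (∀ j, 0 ≤ r j ∧ r j < 1) ∧
    (∀ i : Fin d, ∃ z : ℤ, ∑ j, r j * (v j i : ℝ) = (z : ℝ)) ∧
    (∃ z : ℤ, ∑ j, r j = (z : ℝ))}

/-- The height `ht(α) = ∑ᵢ αᵢ`. -/
def ht {m : ℕ} (α : Fin m → ℝ) : ℝ := ∑ i, α i

/-- The support `supp(α) = {i : αᵢ > 0}`. -/
def suppOf {m : ℕ} (α : Fin m → ℝ) : Set (Fin m) := {i | 0 < α i}

/-- Addition on `Λ_Δ`: coordinatewise fractional part of the sum. -/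
noncomputable def fadd {m : ℕ} (α β : Fin m → ℝ) : Fin m → ℝ := fun i => Int.fract (α i + β i)

/-- Negation on `Λ_Δ`: coordinatewise fractional part of `1 - αᵢ`. -/
noncomputable def fneg {m : ℕ} (α : Fin m → ℝ) : Fin m → ℝ := fun i => Int.fract (1 - α i)

/-- `P ⊆ ℝ^d` is a lattice polytope of dimension `d`: the convex hull of a finite
set of lattice points whose affine span is all of `ℝ^d`. -/
def IsFullDimLatticePolytope {d : ℕ} (P : Set (Fin d → ℝ)) : Prop :=
  ∃ V : Finset (Fin d → ℤ),
    P = convexHull ℝ (toReal '' (V : Set (Fin d → ℤ))) ∧ affineSpan ℝ P = ⊤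

lemma eq_of_sum_eq_of_sum_mul_eq {d : ℕ} {v : Fin (d + 1) → Fin d → ℤ}
    (hv : AffineIndependent ℝ (fun j => toReal (v j))) {a b : Fin (d + 1) → ℝ}
    (h1 : ∑ j, a j = ∑ j, b j)
    (h2 : ∀ i, ∑ j, a j * (v j i : ℝ) = ∑ j, b j * (v j i : ℝ)) : a = b := by
  funext j
  have := affineIndependent_iff.1 hv Finset.univ (fun j => a j - b j)
    (by simp [Finset.sum_sub_distrib, h1])
    (by
      funext i
      simp [toReal, Finset.sum_apply, sub_mul, Finset.sum_sub_distrib, h2])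
    j (Finset.mem_univ _)
  simpa [sub_eq_zero] using this

lemma Lambda_finite {d : ℕ} {v : Fin (d + 1) → Fin d → ℤ}
    (hv : AffineIndependent ℝ (fun j => toReal (v j))) : (Lambda v).Finite := by
  let f : (Fin (d + 1) → ℝ) → (Fin d → ℤ) × ℤ :=
    fun r => (fun i => ⌊∑ j, r j * (v j i : ℝ)⌋, ⌊∑ j, r j⌋)
  refine Set.Finite.of_finite_image (f := f)
    (((Set.finite_Icc (fun i => -∑ j, |v j i|) (fun i => ∑ j, |v j i|)).prod
      (Set.finite_Icc 0 ((d + 1 : ℕ) : ℤ))).subset ?_) ?_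
  · rintro _ ⟨r, ⟨hr, -, -⟩, rfl⟩
    have key : ∀ i, |∑ j, r j * (v j i : ℝ)| ≤ ((∑ j, |v j i| : ℤ) : ℝ) := by
      intro i
      push_cast
      refine (Finset.abs_sum_le_sum_abs _ _).trans (Finset.sum_le_sum fun j _ => ?_)
      rw [abs_mul, abs_of_nonneg (hr j).1]
      exact mul_le_of_le_one_left (abs_nonneg _) (hr j).2.le
    refine ⟨⟨fun i => ?_, fun i => ?_⟩, ⟨?_, ?_⟩⟩
    · refine Int.le_floor.2 ?_
      push_cast
      have := (abs_le.1 (key i)).1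
      push_cast at this
      exact this
    · exact Int.cast_le.1 ((Int.floor_le _).trans (abs_le.1 (key i)).2)
    · exact Int.le_floor.2 (by simpa using Finset.sum_nonneg fun j _ => (hr j).1)
    · refine Int.cast_le (R := ℝ).1 ((Int.floor_le _).trans ?_)
      refine (Finset.sum_le_sum fun j _ => (hr j).2.le).trans ?_
      simp
  · rintro a ⟨-, ha, za, hza⟩ b ⟨-, hb, zb, hzb⟩ hab
    obtain ⟨h1, h2⟩ := Prod.mk.inj hab
    refine eq_of_sum_eq_of_sum_mul_eq hv ?_ fun i => ?_
    · rw [hza, hzb, Int.floor_intCast, Int.floor_intCast] at h2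
      rw [hza, hzb, h2]
    · obtain ⟨z, hz⟩ := ha i
      obtain ⟨z', hz'⟩ := hb i
      have := congrFun h1 i
      simp only [hz, hz', Int.floor_intCast] at this
      rw [hz, hz', this]

lemma fract_mem_Lambda {d : ℕ} {v : Fin (d + 1) → Fin d → ℤ} {w : Fin (d + 1) → ℝ}
    (h1 : ∀ i : Fin d, ∃ z : ℤ, ∑ j, w j * (v j i : ℝ) = (z : ℝ))
    (h2 : ∃ z : ℤ, ∑ j, w j = (z : ℝ)) : (fun j => Int.fract (w j)) ∈ Lambda v := by
  refine ⟨fun j => ⟨Int.fract_nonneg _, Int.fract_lt_one _⟩, fun i => ?_, ?_⟩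
  · obtain ⟨z, hz⟩ := h1 i
    refine ⟨z - ∑ j, ⌊w j⌋ * v j i, ?_⟩
    simp [Int.fract, -Int.self_sub_floor, sub_mul, Finset.sum_sub_distrib, hz]
  · obtain ⟨z, hz⟩ := h2
    refine ⟨z - ∑ j, ⌊w j⌋, ?_⟩
    simp [Int.fract, -Int.self_sub_floor, Finset.sum_sub_distrib, hz]

lemma fadd_mem_Lambda {d : ℕ} {v : Fin (d + 1) → Fin d → ℤ} {a b : Fin (d + 1) → ℝ}
    (ha : a ∈ Lambda v) (hb : b ∈ Lambda v) : fadd a b ∈ Lambda v := by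
  refine fract_mem_Lambda (fun i => ?_) ?_
  · obtain ⟨z, hz⟩ := ha.2.1 i
    obtain ⟨z', hz'⟩ := hb.2.1 i
    exact ⟨z + z', by simp [add_mul, Finset.sum_add_distrib, hz, hz']⟩
  · obtain ⟨z, hz⟩ := ha.2.2
    obtain ⟨z', hz'⟩ := hb.2.2
    exact ⟨z + z', by simp [Finset.sum_add_distrib, hz, hz']⟩

lemma fneg_mem_Lambda {d : ℕ} {v : Fin (d + 1) → Fin d → ℤ} {a : Fin (d + 1) → ℝ}
    (ha : a ∈ Lambda v) : fneg a ∈ Lambda v := by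
  refine fract_mem_Lambda (fun i => ?_) ?_
  · obtain ⟨z, hz⟩ := ha.2.1 i
    exact ⟨∑ j, v j i - z, by simp [sub_mul, Finset.sum_sub_distrib, hz]⟩
  · obtain ⟨z, hz⟩ := ha.2.2
    exact ⟨(d + 1 : ℕ) - z, by simp [Finset.sum_sub_distrib, hz]⟩

lemma zero_mem_Lambda {d : ℕ} (v : Fin (d + 1) → Fin d → ℤ) : (0 : Fin (d + 1) → ℝ) ∈ Lambda v :=
  ⟨fun _ => by simp, fun _ => ⟨0, by simp⟩, 0, by simp⟩

lemma fneg_apply {m : ℕ} {a : Fin m → ℝ} {j : Fin m} (h0 : 0 ≤ a j) (h1 : a j < 1) :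
    fneg a j = if a j = 0 then 0 else 1 - a j := by
  unfold fneg
  split_ifs with h
  · simp [h]
  · exact Int.fract_eq_self.2 ⟨by linarith, by linarith [h0.lt_of_ne' h]⟩

lemma fneg_fneg {m : ℕ} {a : Fin m → ℝ} (h : ∀ j, 0 ≤ a j ∧ a j < 1) : fneg (fneg a) = a := by
  funext j
  have h1 : fneg a j = _ := fneg_apply (h j).1 (h j).2
  rw [fneg_apply (Int.fract_nonneg _) (Int.fract_lt_one _), h1]
  have := (h j).2
  by_cases h0 : a j = 0
  · simp [h0]
  · have : 1 - a j ≠ 0 := by linarith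
    simp [h0, this]

lemma ht_add_ht_fneg {m : ℕ} {a : Fin m → ℝ} (h : ∀ j, 0 ≤ a j ∧ a j < 1) :
    ht a + ht (fneg a) = ((Finset.univ.filter fun j => a j ≠ 0).card : ℝ) := by
  rw [ht, ht, ← Finset.sum_add_distrib, Finset.card_filter, Nat.cast_sum]
  refine Finset.sum_congr rfl fun j _ => ?_
  rw [fneg_apply (h j).1 (h j).2]
  by_cases h0 : a j = 0 <;> simp [h0]

lemma ht_fadd_le {m : ℕ} {a b : Fin m → ℝ} (ha : ∀ j, 0 ≤ a j) (hb : ∀ j, 0 ≤ b j) :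
    ht (fadd a b) ≤ ht a + ht b := by
  rw [ht, ht, ht, ← Finset.sum_add_distrib]
  refine Finset.sum_le_sum fun j _ => ?_
  have : (0 : ℝ) ≤ ⌊a j + b j⌋ := by exact_mod_cast Int.floor_nonneg.2 (add_nonneg (ha j) (hb j))
  have h2 := Int.self_sub_floor (a j + b j)
  simp only [fadd]
  linarith

lemma fadd_right_injOn {d : ℕ} (v : Fin (d + 1) → Fin d → ℤ) (a : Fin (d + 1) → ℝ) :
    Set.InjOn (fun b => fadd b a) (Lambda v) := by
  intro b hb c hc hbc
  funext j
  have h := congrFun hbc j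
  simp only [fadd] at h
  obtain ⟨z, hz⟩ := Int.fract_eq_fract.1 h
  have h1 := hb.1 j
  have h2 := hc.1 j
  have hz1 : z < 1 := by
    have : (z : ℝ) < 1 := by linarith
    exact_mod_cast this
  have hz2 : -1 < z := by
    have : (-1 : ℝ) < z := by linarith
    exact_mod_cast this
  obtain rfl : z = 0 := by omega
  simp at hz
  linarith

section Gap

variable {d k : ℕ} {v : Fin (d + 1) → Fin d → ℤ}

lemma fadd_ht_le (hgap : ∀ α ∈ Lambda v, ht α ≤ k ∨ 2 * k + 1 ≤ ht α) {a b : Fin (d + 1) → ℝ}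
    (ha : a ∈ Lambda v) (hak : ht a ≤ k) (hb : b ∈ Lambda v) (hbk : ht b ≤ k) :
    ht (fadd a b) ≤ k := by
  rcases hgap _ (fadd_mem_Lambda ha hb) with h | h
  · exact h
  · have := ht_fadd_le (fun j => (ha.1 j).1) (fun j => (hb.1 j).1)
    linarith

lemma fneg_ht_le (hfin : (Lambda v).Finite)
    (hgap : ∀ α ∈ Lambda v, ht α ≤ k ∨ 2 * k + 1 ≤ ht α) {a : Fin (d + 1) → ℝ}
    (ha : a ∈ Lambda v) (hak : ht a ≤ k) : ht (fneg a) ≤ k := by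
  have hHfin : {α | α ∈ Lambda v ∧ ht α ≤ k}.Finite := hfin.subset fun _ h => h.1
  have hsurj : Set.SurjOn (fun b => fadd b a) {α | α ∈ Lambda v ∧ ht α ≤ k}
      {α | α ∈ Lambda v ∧ ht α ≤ k} := by
    lift {α | α ∈ Lambda v ∧ ht α ≤ k} to Finset (Fin (d + 1) → ℝ) using hHfin with H hH
    refine Finset.surjOn_of_injOn_of_card_le _ ?_ ?_ le_rfl
    · rw [hH]
      exact fun b hb => ⟨fadd_mem_Lambda hb.1 ha, fadd_ht_le hgap hb.1 hb.2 ha hak⟩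
    · rw [hH]
      exact (fadd_right_injOn v a).mono fun _ h => h.1
  obtain ⟨b, ⟨hb, hbk⟩, hba⟩ := hsurj ⟨zero_mem_Lambda v, by simp [ht]⟩
  have : fneg a = b := by
    funext j
    have hj := congrFun hba j
    simp only [fadd, Pi.zero_apply] at hj
    obtain ⟨z, hz⟩ := Int.fract_eq_zero_iff.1 hj
    have h1 := ha.1 j
    have h2 := hb.1 j
    have : fneg a j = Int.fract (b j) := by
      rw [fneg, Int.fract_eq_fract]
      exact ⟨1 - z, by push_cast; linarith⟩
    rw [this, Int.fract_eq_self.2 h2]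
  rwa [this]

lemma card_support_le (hfin : (Lambda v).Finite)
    (hgap : ∀ α ∈ Lambda v, ht α ≤ k ∨ 2 * k + 1 ≤ ht α) (U : Finset (Fin (d + 1)))
    (hU : ∀ i ∈ U, ∃ α ∈ Lambda v, ht α ≤ k ∧ α i ≠ 0) : U.card ≤ 4 * k := by
  classical
  have hHfin : {α | α ∈ Lambda v ∧ ht α ≤ k}.Finite := hfin.subset fun _ h => h.1
  obtain ⟨H, hH⟩ : ∃ H : Finset (Fin (d + 1) → ℝ), ∀ α, α ∈ H ↔ α ∈ Lambda v ∧ ht α ≤ k :=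
    ⟨hHfin.toFinset, by simp⟩
  have hHpos : 0 < H.card :=
    Finset.card_pos.2 ⟨0, (hH 0).2 ⟨zero_mem_Lambda v, by simp [ht]⟩⟩
  have hhalf : ∀ i ∈ U, H.card ≤ 2 * (H.filter fun α => α i ≠ 0).card := by
    intro i hi
    obtain ⟨a, ha, hak, hai⟩ := hU i hi
    have hle : (H.filter fun α => α i = 0).card ≤ (H.filter fun α => α i ≠ 0).card := by
      refine Finset.card_le_card_of_injOn (fun b => fadd b a) ?_ ?_
      · intro b hb
        simp only [Finset.coe_filter, Set.mem_ofPred_eq, hH] at hb ⊢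
        refine ⟨⟨fadd_mem_Lambda hb.1.1 ha, fadd_ht_le hgap hb.1.1 hb.1.2 ha hak⟩, ?_⟩
        simpa [fadd, hb.2, Int.fract_eq_self.2 (ha.1 i)] using hai
      · refine (fadd_right_injOn v a).mono fun b hb => ?_
        simp only [Finset.coe_filter, Set.mem_ofPred_eq, hH] at hb
        exact hb.1.1
    have := Finset.card_filter_add_card_filter_not (s := H) (fun α => α i = 0)
    simp only [ne_eq] at *
    omega
  have hsupp : ∀ α ∈ H, (U.filter fun i => α i ≠ 0).card ≤ 2 * k := by
    intro α hα
    obtain ⟨h1, h2⟩ := (hH α).1 hα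
    have h3 := ht_add_ht_fneg h1.1
    have h4 := fneg_ht_le hfin hgap h1 h2
    have h5 : ((Finset.univ.filter fun j => α j ≠ 0).card : ℝ) ≤ (2 * k : ℕ) := by
      push_cast
      linarith
    exact (Finset.card_le_card (Finset.filter_subset_filter _ (Finset.subset_univ _))).trans
      (by exact_mod_cast h5)
  have hdouble := Finset.sum_card_bipartiteAbove_eq_sum_card_bipartiteBelow
    (s := U) (t := H) (fun i α => α i ≠ 0)
  have h1 : U.card * H.card ≤ 2 * ∑ i ∈ U, (H.filter fun α => α i ≠ 0).card := by
    rw [Finset.mul_sum, ← smul_eq_mul, ← Finset.sum_const]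
    exact Finset.sum_le_sum hhalf
  have h2 : ∑ α ∈ H, (U.filter fun i => α i ≠ 0).card ≤ H.card * (2 * k) := by
    rw [← smul_eq_mul, ← Finset.sum_const]
    exact Finset.sum_le_sum hsupp
  simp only [Finset.bipartiteAbove, Finset.bipartiteBelow] at hdouble
  rw [hdouble] at h1
  refine Nat.le_of_mul_le_mul_right (c := H.card) ?_ hHpos
  linarith

lemma exists_face_forall_supp_iff (hfin : (Lambda v).Finite)
    (hgap : ∀ α ∈ Lambda v, ht α ≤ k ∨ 2 * k + 1 ≤ ht α) :
    ∃ S : Finset (Fin (d + 1)), S.Nonempty ∧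
      ∀ α ∈ Lambda v, (∀ i, α i ≠ 0 → i ∈ S) ↔ ht α ≤ k := by
  classical
  obtain ⟨U, hU⟩ : ∃ U : Finset (Fin (d + 1)),
      ∀ i, i ∈ U ↔ ∃ α ∈ Lambda v, ht α ≤ k ∧ α i ≠ 0 :=
    ⟨Finset.univ.filter fun i => ∃ α ∈ Lambda v, ht α ≤ k ∧ α i ≠ 0, by simp⟩
  rcases U.eq_empty_or_nonempty with hempty | hne
  · refine ⟨{0}, Finset.singleton_nonempty 0, fun α hα => ⟨fun h => ?_, fun h i hi => ?_⟩⟩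
    · obtain ⟨z, hz⟩ := hα.2.2
      have hsum : ∑ j, α j = α 0 :=
        Finset.sum_eq_single 0 (fun j _ hj => by_contra fun hj' => hj (by simpa using h j hj'))
          (by simp)
      have h0 := hα.1 0
      rw [← hsum, hz] at h0
      have hz0 : z = 0 := by
        have h1 : 0 ≤ z := by exact_mod_cast h0.1
        have h2 : z < 1 := by exact_mod_cast h0.2
        omega
      rw [ht, hz, hz0]
      simp
    · have : i ∈ U := (hU i).2 ⟨α, hα, h, hi⟩
      simp [hempty] at this
  · refine ⟨U, hne, fun α hα => ⟨fun h => ?_, fun h i hi => (hU i).2 ⟨α, hα, h, hi⟩⟩⟩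
    by_contra hlow
    have h1 := (hgap α hα).resolve_left hlow
    have h2 : ¬ ht (fneg α) ≤ k := fun h' =>
      hlow (by simpa [fneg_fneg hα.1] using fneg_ht_le hfin hgap (fneg_mem_Lambda hα) h')
    have h3 := (hgap _ (fneg_mem_Lambda hα)).resolve_left h2
    have h4 := ht_add_ht_fneg hα.1
    have h5 : (Finset.univ.filter fun j => α j ≠ 0).card ≤ 4 * k :=
      (Finset.card_le_card fun i hi => h i (by simpa using hi)).trans
        (card_support_le hfin hgap U fun i hi => (hU i).1 hi)
    have h6 : ((Finset.univ.filter fun j => α j ≠ 0).card : ℝ) ≤ 4 * k := by exact_mod_cast h5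
    linarith

end Gap

/-- The barycentric weights of the lattice points of the `n`-th dilate of a face. -/
def faceWeights {d : ℕ} (v : Fin (d + 1) → Fin d → ℤ) (S : Finset (Fin (d + 1))) (n : ℕ) :
    Set (Fin (d + 1) → ℝ) :=
  {w | (∀ j, 0 ≤ w j) ∧ (∀ j, w j ≠ 0 → j ∈ S) ∧
    (∀ i : Fin d, ∃ z : ℤ, ∑ j, w j * (v j i : ℝ) = (z : ℝ)) ∧ ∑ j, w j = n}

lemma mem_convexHull_image_iff {d : ℕ} {p : Fin (d + 1) → Fin d → ℝ} {S : Finset (Fin (d + 1))}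
    {x : Fin d → ℝ} :
    x ∈ convexHull ℝ (p '' (S : Set (Fin (d + 1)))) ↔
      ∃ w : Fin (d + 1) → ℝ, (∀ j, 0 ≤ w j) ∧ (∀ j, w j ≠ 0 → j ∈ S) ∧ ∑ j, w j = 1 ∧
        ∑ j, w j • p j = x := by
  classical
  constructor
  · intro hx
    refine convexHull_min (t := {x | ∃ w : Fin (d + 1) → ℝ, (∀ j, 0 ≤ w j) ∧
      (∀ j, w j ≠ 0 → j ∈ S) ∧ ∑ j, w j = 1 ∧ ∑ j, w j • p j = x}) ?_ ?_ hx
    · rintro _ ⟨j, hj, rfl⟩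
      refine ⟨Pi.single j 1, fun i => ?_, fun i hi => ?_, by simp, ?_⟩
      · by_cases h : i = j
        · subst h; simp
        · simp [h]
      · by_cases h : i = j
        · subst h; exact hj
        · simp [h] at hi
      · simp [Pi.single_apply]
    · rintro _ ⟨w, hw0, hwS, hw1, rfl⟩ _ ⟨u, hu0, huS, hu1, rfl⟩ a b ha hb hab
      refine ⟨fun j => a * w j + b * u j, fun j => ?_, fun j hj => ?_, ?_, ?_⟩
      · have := hw0 j; have := hu0 j; positivity
      · by_contra hS
        have h1 : w j = 0 := by_contra fun h => hS (hwS j h)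
        have h2 : u j = 0 := by_contra fun h => hS (huS j h)
        simp [h1, h2] at hj
      · rw [Finset.sum_add_distrib, ← Finset.mul_sum, ← Finset.mul_sum, hw1, hu1]
        linarith
      · simp [add_smul, Finset.sum_add_distrib, mul_smul, Finset.smul_sum]
  · rintro ⟨w, hw0, hwS, hw1, rfl⟩
    have hz : ∀ j ∈ Finset.univ, j ∉ S → w j = 0 := fun j _ hj => by_contra fun h => hj (hwS j h)
    rw [← Finset.sum_subset (Finset.subset_univ S)
      (fun j hj hjS => by rw [hz j hj hjS, zero_smul])]
    refine (convex_convexHull ℝ _).sum_mem (fun j _ => hw0 j) ?_ fun j hj =>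
      subset_convexHull ℝ _ ⟨j, hj, rfl⟩
    rw [← hw1]
    exact Finset.sum_subset (Finset.subset_univ S) hz

lemma latticeCount_eq_ncard_faceWeights {d : ℕ} {v : Fin (d + 1) → Fin d → ℤ}
    (hv : AffineIndependent ℝ (fun j => toReal (v j))) (S : Finset (Fin (d + 1))) {n : ℕ}
    (hn : 1 ≤ n) :
    latticeCount (convexHull ℝ ((fun j => toReal (v j)) '' (S : Set (Fin (d + 1))))) n =
      (faceWeights v S n).ncard := by
  let f : (Fin (d + 1) → ℝ) → Fin d → ℤ := fun w i => ⌊∑ j, w j * (v j i : ℝ)⌋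
  have hf : ∀ w ∈ faceWeights v S n, ∀ i, ∑ j, w j * (v j i : ℝ) = (f w i : ℝ) := by
    rintro w ⟨-, -, hw, -⟩ i
    obtain ⟨z, hz⟩ := hw i
    simp [f, hz]
  have hinj : Set.InjOn f (faceWeights v S n) := by
    intro a ha b hb hab
    refine eq_of_sum_eq_of_sum_mul_eq hv (by rw [ha.2.2.2, hb.2.2.2]) fun i => ?_
    rw [hf a ha, hf b hb, hab]
  have hn0 : (0 : ℝ) < n := by exact_mod_cast hn
  rw [← hinj.ncard_image, latticeCount]
  congr 1
  ext x
  constructor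
  · rintro ⟨y, hy, hyx⟩
    obtain ⟨w, hw0, hwS, hw1, rfl⟩ := mem_convexHull_image_iff.1 hy
    have hx : ∀ i, ∑ j, (n * w j) * (v j i : ℝ) = (x i : ℝ) := by
      intro i
      have := congrFun hyx i
      simpa [toReal, Finset.sum_apply, Finset.mul_sum, mul_assoc] using this
    refine ⟨fun j => n * w j, ⟨fun j => mul_nonneg hn0.le (hw0 j),
      fun j hj => hwS j (right_ne_zero_of_mul hj), fun i => ⟨_, hx i⟩, ?_⟩, ?_⟩
    · rw [← Finset.mul_sum, hw1, mul_one]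
    · funext i
      simp [f, hx]
  · rintro ⟨w, hw, rfl⟩
    refine ⟨(n : ℝ)⁻¹ • toReal (f w), mem_convexHull_image_iff.2
      ⟨fun j => (n : ℝ)⁻¹ * w j, fun j => mul_nonneg (by positivity) (hw.1 j),
        fun j hj => hw.2.1 j (right_ne_zero_of_mul hj), ?_, ?_⟩, ?_⟩
    · rw [← Finset.mul_sum, hw.2.2.2, inv_mul_cancel₀ hn0.ne']
    · funext i
      simp [toReal, Finset.sum_apply, mul_assoc, ← Finset.mul_sum, hf w hw i]
    · simp [smul_smul, hn0.ne']

lemma ht_eq_floor {d : ℕ} {v : Fin (d + 1) → Fin d → ℤ} {α : Fin (d + 1) → ℝ}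
    (hα : α ∈ Lambda v) : ht α = (⌊ht α⌋₊ : ℝ) := by
  obtain ⟨z, hz⟩ := hα.2.2
  have h0 : 0 ≤ ht α := Finset.sum_nonneg fun j _ => (hα.1 j).1
  have hz' : ht α = z := hz
  rw [hz'] at h0 ⊢
  lift z to ℕ using (by exact_mod_cast h0)
  simp

lemma ncard_faceWeights {d : ℕ} {v : Fin (d + 1) → Fin d → ℤ} {S : Finset (Fin (d + 1))}
    (L : Finset (Fin (d + 1) → ℝ)) (hL : ∀ α, α ∈ L ↔ α ∈ Lambda v ∧ ∀ i, α i ≠ 0 → i ∈ S)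
    (n : ℕ) :
    (faceWeights v S n).ncard =
      ∑ α ∈ L, if ⌊ht α⌋₊ ≤ n then (S.finsuppAntidiag (n - ⌊ht α⌋₊)).card else 0 := by
  classical
  let F : Finset (Σ _ : Fin (d + 1) → ℝ, Fin (d + 1) →₀ ℕ) :=
    L.sigma fun α => if ⌊ht α⌋₊ ≤ n then S.finsuppAntidiag (n - ⌊ht α⌋₊) else ∅
  let g : (Σ _ : Fin (d + 1) → ℝ, Fin (d + 1) →₀ ℕ) → Fin (d + 1) → ℝ :=
    fun p j => p.1 j + p.2 j
  have hF : ∀ p, p ∈ F ↔ (p.1 ∈ Lambda v ∧ ∀ i, p.1 i ≠ 0 → i ∈ S) ∧ ⌊ht p.1⌋₊ ≤ n ∧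
      p.2 ∈ S.finsuppAntidiag (n - ⌊ht p.1⌋₊) := by
    intro p
    simp only [F, Finset.mem_sigma, hL]
    split_ifs with h <;> simp [h]
  have hinj : Set.InjOn g F := by
    rintro ⟨a, b⟩ hp ⟨a', b'⟩ hq hpq
    have ha := ((hF _).1 hp).1.1.1
    have ha' := ((hF _).1 hq).1.1.1
    have hfl : ∀ j, b j = b' j ∧ a j = a' j := by
      intro j
      have h := congrFun hpq j
      simp only [g] at h ha ha'
      have hb : (b j : ℕ) = b' j := by
        have h1 : (b j : ℝ) < b' j + 1 := by linarith [ha j, ha' j]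
        have h2 : (b' j : ℝ) < b j + 1 := by linarith [ha j, ha' j]
        have h1' : b j < b' j + 1 := by exact_mod_cast h1
        have h2' : b' j < b j + 1 := by exact_mod_cast h2
        omega
      exact ⟨hb, by rw [hb] at h; linarith⟩
    obtain rfl : a = a' := funext fun j => (hfl j).2
    obtain rfl : b = b' := Finsupp.ext fun j => (hfl j).1
    rfl
  have himage : faceWeights v S n = g '' (F : Set _) := by
    ext w
    constructor
    · rintro ⟨hw0, hwS, hwi, hwn⟩
      have hmem : (fun j => Int.fract (w j)) ∈ Lambda v :=
        fract_mem_Lambda hwi ⟨n, by simpa using hwn⟩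
      have hfr : ∀ j, w j = Int.fract (w j) + (⌊w j⌋₊ : ℝ) := by
        intro j
        rw [natCast_floor_eq_intCast_floor (hw0 j), Int.fract_add_floor]
      have hsum : (n : ℝ) = ht (fun j => Int.fract (w j)) + ((∑ j, ⌊w j⌋₊ : ℕ) : ℝ) := by
        push_cast
        rw [← hwn, ht, ← Finset.sum_add_distrib]
        exact Finset.sum_congr rfl fun j _ => hfr j
      rw [ht_eq_floor hmem] at hsum
      have hsum' : n = ⌊ht fun j => Int.fract (w j)⌋₊ + ∑ j, ⌊w j⌋₊ := by exact_mod_cast hsum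
      have hz : ∀ j, j ∉ S → w j = 0 := fun j hj => by_contra fun h => hj (hwS j h)
      refine ⟨⟨fun j => Int.fract (w j), Finsupp.equivFunOnFinite.symm fun j => ⌊w j⌋₊⟩,
        (hF _).2 ⟨⟨hmem, fun j hj => hwS j fun h => hj (by simp [h])⟩, hsum' ▸ Nat.le_add_right _ _, ?_⟩, ?_⟩
      · rw [Finset.mem_finsuppAntidiag]
        refine ⟨?_, fun j hj => hwS j fun h => by simp [h] at hj⟩
        have : ∑ j ∈ S, ⌊w j⌋₊ = ∑ j, ⌊w j⌋₊ :=
          Finset.sum_subset (Finset.subset_univ S) fun j _ hj => by simp [hz j hj]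
        simp only [Finsupp.equivFunOnFinite_symm_apply_apply]
        omega
      · funext j
        simpa [g] using (hfr j).symm
    · rintro ⟨⟨a, b⟩, hp, rfl⟩
      obtain ⟨⟨ha, haS⟩, hle, hb⟩ := (hF _).1 hp
      rw [Finset.mem_finsuppAntidiag] at hb
      dsimp only at ha haS hle hb
      obtain ⟨hbsum, hbS⟩ := hb
      have hz : ∀ j, j ∉ S → b j = 0 := fun j hj => by_contra fun h =>
        hj (hbS (Finsupp.mem_support_iff.2 h))
      have hbsum' : ∑ j, b j = n - ⌊ht a⌋₊ := by
        rw [← hbsum]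
        exact (Finset.sum_subset (Finset.subset_univ S) fun j _ hj => hz j hj).symm
      refine ⟨fun j => add_nonneg (ha.1 j).1 (Nat.cast_nonneg _), fun j hj => ?_, fun i => ?_, ?_⟩
      · by_contra hjS
        have h1 : a j = 0 := by_contra fun h => hjS (haS j h)
        simp [g, h1, hz j hjS] at hj
      · obtain ⟨z, hz⟩ := ha.2.1 i
        exact ⟨z + ∑ j, b j * v j i, by simp [g, add_mul, Finset.sum_add_distrib, hz]⟩
      · have h1 : ∑ j, a j = (⌊ht a⌋₊ : ℝ) := ht_eq_floor ha
        simp only [g]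
        rw [Finset.sum_add_distrib, h1, ← Nat.cast_sum, hbsum', Nat.cast_sub hle]
        ring
  rw [himage, hinj.ncard_image, Set.ncard_coe_finset, Finset.card_sigma]
  refine Finset.sum_congr rfl fun α _ => ?_
  split_ifs <;> simp

lemma antidiag_card_eq_choose {d : ℕ} {v : Fin (d + 1) → Fin d → ℤ} {S : Finset (Fin (d + 1))}
    (hS : S.Nonempty) {α : Fin (d + 1) → ℝ} (hα : α ∈ Lambda v) (hαS : ∀ i, α i ≠ 0 → i ∈ S)
    (n : ℕ) :
    (if ⌊ht α⌋₊ ≤ n then (S.finsuppAntidiag (n - ⌊ht α⌋₊)).card else 0) =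
      Nat.choose (n + (S.card - 1) - ⌊ht α⌋₊) (S.card - 1) := by
  have hpos := hS.card_pos
  split_ifs with h
  · rw [Finset.card_finsuppAntidiag_nat_eq_choose]
    rw [show n + (S.card - 1) - ⌊ht α⌋₊ = S.card + (n - ⌊ht α⌋₊) - 1 by omega]
    exact Nat.choose_symm_of_eq_add (by omega)
  · have hlt : ht α < S.card := by
      have h1 : ht α = ∑ j ∈ S, α j :=
        (Finset.sum_subset (Finset.subset_univ S)
          fun j _ hj => by_contra fun h => hj (hαS j h)).symm
      rw [h1]
      calc ∑ j ∈ S, α j < ∑ j ∈ S, (1 : ℝ) :=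
            Finset.sum_lt_sum_of_nonempty hS fun j _ => (hα.1 j).2
        _ = S.card := by simp
    rw [ht_eq_floor hα] at hlt
    have hlt' : ⌊ht α⌋₊ < S.card := by exact_mod_cast hlt
    exact (Nat.choose_eq_zero_of_lt (by omega)).symm

/-- if `h_{k+1} = ⋯ = h_{2k} = 0` for the lattice simplex `Δ` with
vertices `v`, then some face `Δ' = conv{vᵢ : i ∈ S}` has h*-polynomial `∑_{i=0}^k hᵢ tⁱ`. -/
theorem stmt0 (d k : ℕ) (hk : 3 ≤ k) (v : Fin (d + 1) → Fin d → ℤ)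
    (hv : AffineIndependent ℝ (fun j => toReal (v j)))
    (h : ℕ → ℕ)
    (hdef : ∀ i : ℕ, h i = Set.ncard {α | α ∈ Lambda v ∧ ht α = (i : ℝ)})
    (hvanish : ∀ i : ℕ, k + 1 ≤ i → i ≤ 2 * k → h i = 0) :
    ∃ S : Finset (Fin (d + 1)), S.Nonempty ∧
      ∀ n : ℕ, 1 ≤ n →
        latticeCount (convexHull ℝ ((fun j => toReal (v j)) '' (S : Set (Fin (d + 1))))) n =
          ∑ i ∈ Finset.range (k + 1),
            h i * Nat.choose (n + (S.card - 1) - i) (S.card - 1) := by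
  classical
  have hfin := Lambda_finite hv
  have hgap : ∀ α ∈ Lambda v, ht α ≤ k ∨ 2 * (k : ℝ) + 1 ≤ ht α := by
    intro α hα
    by_contra! hcon
    have hfl := ht_eq_floor hα
    rw [hfl] at hcon
    have h1 : k < ⌊ht α⌋₊ := by exact_mod_cast hcon.1
    have h2 : ⌊ht α⌋₊ < 2 * k + 1 := by exact_mod_cast hcon.2
    have h3 := hvanish ⌊ht α⌋₊ h1 (by omega)
    rw [hdef, Set.ncard_eq_zero (hfin.subset fun _ h => h.1)] at h3
    exact Set.notMem_empty α (h3 ▸ ⟨hα, hfl⟩)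
  obtain ⟨S, hS, hSα⟩ := exists_face_forall_supp_iff hfin hgap
  refine ⟨S, hS, fun n hn => ?_⟩
  obtain ⟨L, hL⟩ : ∃ L : Finset (Fin (d + 1) → ℝ),
      ∀ α, α ∈ L ↔ α ∈ Lambda v ∧ ∀ i, α i ≠ 0 → i ∈ S :=
    ⟨(hfin.subset fun _ h => h.1 :
      {α | α ∈ Lambda v ∧ ∀ i, α i ≠ 0 → i ∈ S}.Finite).toFinset, by simp⟩
  rw [latticeCount_eq_ncard_faceWeights hv S hn, ncard_faceWeights L hL n,
    Finset.sum_congr rfl fun α hα =>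
      antidiag_card_eq_choose hS ((hL α).1 hα).1 ((hL α).1 hα).2 n]
  have hmaps : ∀ α ∈ L, ⌊ht α⌋₊ ∈ Finset.range (k + 1) := by
    intro α hα
    obtain ⟨h1, h2⟩ := (hL α).1 hα
    have h3 := (hSα α h1).1 h2
    rw [ht_eq_floor h1] at h3
    have h4 : ⌊ht α⌋₊ ≤ k := by exact_mod_cast h3
    exact Finset.mem_range.2 (by omega)
  rw [← Finset.sum_fiberwise_of_maps_to hmaps]
  refine Finset.sum_congr rfl fun i hi => ?_
  have hcard : h i = (L.filter fun α => ⌊ht α⌋₊ = i).card := by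
    rw [hdef, ← Set.ncard_coe_finset]
    congr 1
    ext α
    simp only [Finset.coe_filter, Set.mem_ofPred_eq, hL]
    constructor
    · rintro ⟨h1, h2⟩
      refine ⟨⟨h1, (hSα α h1).2 ?_⟩, by simp [h2]⟩
      rw [h2]
      exact_mod_cast Nat.lt_succ_iff.1 (Finset.mem_range.1 hi)
    · rintro ⟨⟨h1, -⟩, h2⟩
      exact ⟨h1, by rw [ht_eq_floor h1, h2]⟩
  rw [hcard, ← smul_eq_mul, ← Finset.sum_const]
  exact Finset.sum_congr rfl fun α hα => by rw [(Finset.mem_filter.1 hα).2]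
end

section
/- Let Δ ⊂ ℝ^d be a lattice simplex of dimension d with vertices v_1, …, v_{d+1} ∈ ℤ^d and let k ≥ 3 be an integer. Assume that no α ∈ Λ_Δ satisfies k+1 ≤ ht(α) ≤ 2k. Then for every integer h with 0 ≤ h ≤ k and every α ∈ Λ_Δ with ht(α) = h, one has |α| ≤ k + h. -/
open scoped Pointwise

/-- Every coordinate of a point of `Λ_Δ` has a common positive integer denominator. -/
lemma exists_denominator_of_mem_Lambda {d : ℕ} {v : Fin (d + 1) → Fin d → ℤ}
    (hv : AffineIndependent ℝ (fun j => toReal (v j))) {r : Fin (d + 1) → ℝ}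
    (hr : r ∈ Lambda v) : ∃ N : ℕ, 0 < N ∧ ∀ j, ∃ z : ℤ, (N : ℝ) * r j = z := by
  obtain ⟨-, hcoord, z₀, hz₀⟩ := hr
  choose z hz using hcoord
  let M : Matrix (Fin (d + 1)) (Fin (d + 1)) ℤ :=
    Matrix.of (Fin.cons (fun _ => 1) (fun i j => v j i))
  let A : Matrix (Fin (d + 1)) (Fin (d + 1)) ℝ := M.map (Int.castRingHom ℝ)
  have hA_zero (w : Fin (d + 1) → ℝ) : A.mulVec w 0 = ∑ j, w j := by
    simp [A, M, Matrix.mulVec, dotProduct]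
  have hA_succ (w : Fin (d + 1) → ℝ) (i : Fin d) :
      A.mulVec w i.succ = ∑ j, w j * (v j i : ℝ) := by
    simp [A, M, Matrix.mulVec, dotProduct, mul_comm]
  have hAdet : A.det = (M.det : ℝ) := ((Int.castRingHom ℝ).map_det M).symm
  have hdet : M.det ≠ 0 := by
    intro h
    obtain ⟨w, hw, hAw⟩ := Matrix.exists_mulVec_eq_zero_iff.2
      (show A.det = 0 by rw [hAdet, h, Int.cast_zero])
    refine hw (funext fun j => ?_)
    refine affineIndependent_iff.1 hv Finset.univ w ?_ ?_ j (Finset.mem_univ j)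
    · rw [← hA_zero, hAw, Pi.zero_apply]
    · ext i
      simpa [hAw, toReal, Finset.sum_apply] using (hA_succ w i).symm
  let y : Fin (d + 1) → ℤ := Fin.cons z₀ z
  have hAr : A.mulVec r = fun i => (y i : ℝ) := by
    ext i
    refine Fin.cases ?_ (fun i => ?_) i
    · simp [hA_zero, hz₀, y]
    · simp [hA_succ, hz, y]
  have hdr (j : Fin (d + 1)) : (M.det : ℝ) * r j = (M.adjugate.mulVec y j : ℤ) := by
    have h : A.adjugate.mulVec (A.mulVec r) = A.det • r := by
      rw [Matrix.mulVec_mulVec, Matrix.adjugate_mul, Matrix.smul_mulVec, Matrix.one_mulVec]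
    have hadj : A.adjugate = M.adjugate.map (Int.castRingHom ℝ) :=
      ((Int.castRingHom ℝ).map_adjugate M).symm
    rw [hAr, hadj, hAdet] at h
    have hj := congrFun h j
    simp only [Pi.smul_apply, smul_eq_mul] at hj
    rw [← hj]
    simp [Matrix.mulVec, dotProduct]
  refine ⟨M.det.natAbs, Int.natAbs_pos.2 hdet, fun j => ?_⟩
  rcases Int.natAbs_eq M.det with h | h
  · refine ⟨M.adjugate.mulVec y j, ?_⟩
    rw [← hdr, ← Int.cast_natCast, ← h]
  · refine ⟨-M.adjugate.mulVec y j, ?_⟩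
    have h' : (M.det.natAbs : ℤ) = -M.det := by omega
    rw [Int.cast_neg, ← hdr, ← Int.cast_natCast, h', Int.cast_neg, neg_mul]

/-- The coordinatewise fractional part of a natural multiple of a point of `Λ_Δ` is in `Λ_Δ`. -/
lemma fract_mul_mem_Lambda {d : ℕ} {v : Fin (d + 1) → Fin d → ℤ} {r : Fin (d + 1) → ℝ}
    (hr : r ∈ Lambda v) (n : ℕ) : (fun j => Int.fract (n * r j)) ∈ Lambda v := by
  obtain ⟨-, hcoord, z₀, hz₀⟩ := hr
  refine ⟨fun j => ⟨Int.fract_nonneg _, Int.fract_lt_one _⟩, fun i => ?_, ?_⟩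
  · obtain ⟨z, hz⟩ := hcoord i
    refine ⟨n * z - ∑ j, ⌊n * r j⌋ * v j i, ?_⟩
    push_cast
    simp only [← hz, Int.fract, sub_mul, Finset.sum_sub_distrib, Finset.mul_sum, mul_assoc]
  · refine ⟨n * z₀ - ∑ j, ⌊n * r j⌋, ?_⟩
    push_cast
    simp only [← hz₀, Int.fract, Finset.sum_sub_distrib, Finset.mul_sum]

/-- The size of the support is the sum of the heights of a point and its negative. -/
lemma ncard_suppOf_eq {m : ℕ} {α : Fin m → ℝ} (hα : ∀ j, 0 ≤ α j ∧ α j < 1) :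
    ((suppOf α).ncard : ℝ) = ht (fun j => Int.fract (-α j)) + ht α := by
  classical
  have hs : suppOf α = (Finset.univ.filter fun j => 0 < α j : Finset (Fin m)) := by
    ext j
    simp [suppOf]
  rw [hs, Set.ncard_coe_finset, ht, ht, ← Finset.sum_add_distrib, Finset.card_filter,
    Nat.cast_sum]
  refine Finset.sum_congr rfl fun j _ => ?_
  have hfr : Int.fract (α j) = α j := Int.fract_eq_self.2 (hα j)
  split_ifs with h
  · rw [Int.fract_neg (by rw [hfr]; exact h.ne'), hfr]
    simp
  · have h0 : α j = 0 := le_antisymm (not_lt.1 h) (hα j).1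
    simp [h0]

/-- If no height lies in `[k+1, 2k]`, then all multiples of a point of height at most `k` have
height at most `k`. -/
lemma ht_fract_mul_le {d k : ℕ} {v : Fin (d + 1) → Fin d → ℤ}
    (hvanish : ∀ α ∈ Lambda v, ¬((k : ℝ) + 1 ≤ ht α ∧ ht α ≤ 2 * (k : ℝ)))
    {α : Fin (d + 1) → ℝ} (hα : α ∈ Lambda v) (hht : ht α ≤ k) (n : ℕ) :
    ht (fun j => Int.fract (n * α j)) ≤ k := by
  induction n with
  | zero => simp [ht]
  | succ n ih =>
    have hmem := fract_mul_mem_Lambda hα (n + 1)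
    have hstep : ht (fun j => Int.fract (((n + 1 : ℕ) : ℝ) * α j)) ≤
        ht (fun j => Int.fract (n * α j)) + ht α := by
      rw [ht, ht, ht, ← Finset.sum_add_distrib]
      refine Finset.sum_le_sum fun j _ => ?_
      rw [Nat.cast_succ, add_one_mul]
      simpa [Int.fract_eq_self.2 (hα.1 j)] using Int.fract_add_le (n * α j) (α j)
    have hlt := lt_of_not_ge fun h => hvanish _ hmem ⟨h, by linarith⟩
    obtain ⟨z, hz⟩ := hmem.2.2
    rw [ht, hz] at hlt ⊢
    have : z < k + 1 := by exact_mod_cast hlt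
    exact_mod_cast Int.lt_add_one_iff.1 this

/-- if no `α ∈ Λ_Δ` has `k+1 ≤ ht(α) ≤ 2k`, then every `α ∈ Λ_Δ`
with `ht(α) = h ≤ k` satisfies `|α| ≤ k + h`. -/
theorem stmt3 (d k : ℕ) (hk : 3 ≤ k) (v : Fin (d + 1) → Fin d → ℤ)
    (hv : AffineIndependent ℝ (fun j => toReal (v j)))
    (hvanish : ∀ α ∈ Lambda v, ¬((k : ℝ) + 1 ≤ ht α ∧ ht α ≤ 2 * (k : ℝ))) :
    ∀ hh : ℕ, hh ≤ k → ∀ α ∈ Lambda v, ht α = (hh : ℝ) →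
      (suppOf α).ncard ≤ k + hh := by
  intro h hle α hα hht
  obtain ⟨N, hN, hint⟩ := exists_denominator_of_mem_Lambda hv hα
  have hneg : (fun j => Int.fract (((N - 1 : ℕ) : ℝ) * α j)) = fun j => Int.fract (-α j) := by
    funext j
    obtain ⟨z, hz⟩ := hint j
    rw [Nat.cast_pred hN, sub_one_mul, hz, sub_eq_add_neg, Int.fract_intCast_add]
  have hbound := ht_fract_mul_le hvanish hα (by rw [hht]; exact_mod_cast hle) (N - 1)
  rw [hneg] at hbound
  have hcard := ncard_suppOf_eq hα.1
  have : ((suppOf α).ncard : ℝ) ≤ k + h := by linarith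
  exact_mod_cast this
end

section
/- For every integer k ≥ 3 and every integer j with k+1 ≤ j ≤ 2k−1, there exist d ≥ 1, a lattice simplex Δ ⊂ ℝ^d of dimension d, and nonnegative integers h_0, h_1, …, h_d with h_0 = 1 such that: (i) #(nΔ ∩ ℤ^d) = Σ_{i=0}^{d} h_i C(n+d−i, d) for every integer n ≥ 1; (ii) h_i = 0 for every i with k+1 ≤ i ≤ 2k−1 and i ≠ j; (iii) h_j ≠ 0; and (iv) there is no e ≥ 1 and no lattice polytope Q ⊂ ℝ^e of dimension e with #(nQ ∩ ℤ^e) = Σ_{i=0}^{k} h_i C(n+e−i, e) for every integer n ≥ 1 (i.e., (h_0, …, h_k) does not satisfy the degree k condition). -/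
open scoped Pointwise

section SimplexEhrhart

variable {ι : Type*} [Fintype ι] {d : ℕ}

/-- The lattice points of a dilated convex hull, in terms of nonnegative weights. -/
theorem toReal_mem_smul_convexHull_range (v : ι → Fin d → ℤ) {n : ℕ} (hn : 1 ≤ n)
    (x : Fin d → ℤ) :
    toReal x ∈ (n : ℝ) • convexHull ℝ (Set.range fun j => toReal (v j)) ↔
      ∃ μ : ι → ℝ, (∀ j, 0 ≤ μ j) ∧ ∑ j, μ j = n ∧ ∀ i, ∑ j, μ j * (v j i : ℝ) = x i := by
  classical
  have hn0 : (n : ℝ) ≠ 0 := by positivity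
  have hrange : (Set.range fun j => toReal (v j)) =
      Fintype.linearCombination ℝ (fun j => toReal (v j)) ''
        Set.range (fun j : ι => (Pi.single j 1 : ι → ℝ)) := by
    rw [← Set.range_comp]
    congr 1
    ext : 1
    simp [Fintype.linearCombination_apply_single]
  rw [hrange, ← LinearMap.image_convexHull, convexHull_rangle_single_eq_stdSimplex,
    Set.mem_smul_set]
  constructor
  · rintro ⟨_, ⟨w, ⟨hw0, hw1⟩, rfl⟩, hx⟩
    refine ⟨fun j => n * w j, fun j => mul_nonneg n.cast_nonneg (hw0 j), ?_, fun i => ?_⟩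
    · rw [← Finset.mul_sum, hw1, mul_one]
    · have := congrFun hx i
      simp only [Fintype.linearCombination_apply, Pi.smul_apply, Finset.sum_apply, smul_eq_mul,
        toReal] at this
      rw [← this, Finset.mul_sum]
      exact Finset.sum_congr rfl fun j _ => mul_assoc _ _ _
  · rintro ⟨μ, h0, h1, hx⟩
    refine ⟨_, ⟨fun j => (n : ℝ)⁻¹ * μ j,
      ⟨fun j => mul_nonneg (by positivity) (h0 j), ?_⟩, rfl⟩, ?_⟩
    · rw [← Finset.mul_sum, h1, inv_mul_cancel₀ hn0]
    · ext i
      simp only [Fintype.linearCombination_apply, Pi.smul_apply, Finset.sum_apply, smul_eq_mul,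
        toReal]
      rw [← hx i, Finset.mul_sum]
      refine Finset.sum_congr rfl fun j _ => ?_
      field_simp

/-- The weights whose total and whose combination of the points `v` are integral. -/
def integralWeights (v : ι → Fin d → ℤ) : AddSubgroup (ι → ℝ) where
  carrier := {r | (∀ i, ∃ z : ℤ, ∑ j, r j * (v j i : ℝ) = z) ∧ ∃ z : ℤ, ∑ j, r j = z}
  zero_mem' := ⟨fun _ => ⟨0, by simp⟩, 0, by simp⟩
  add_mem' := by
    rintro r s ⟨hr, a, ha⟩ ⟨hs, b, hb⟩
    refine ⟨fun i => ?_, a + b, by simp [Finset.sum_add_distrib, ha, hb]⟩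
    obtain ⟨y, hy⟩ := hr i
    obtain ⟨z, hz⟩ := hs i
    exact ⟨y + z, by simp [add_mul, Finset.sum_add_distrib, hy, hz]⟩
  neg_mem' := by
    rintro r ⟨hr, a, ha⟩
    refine ⟨fun i => ?_, -a, by simp [ha]⟩
    obtain ⟨y, hy⟩ := hr i
    exact ⟨-y, by simp [hy]⟩

/-- The integral weights in the half-open unit cube. -/
def boxWeights (v : ι → Fin d → ℤ) : Set (ι → ℝ) :=
  {r | r ∈ integralWeights v ∧ ∀ j, 0 ≤ r j ∧ r j < 1}

/-- The natural number equal to the coordinate sum of a vector of `boxWeights`. -/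
noncomputable def natHeight (r : ι → ℝ) : ℕ := ⌊∑ j, r j⌋₊

theorem natHeight_eq_of_sum_eq {r : ι → ℝ} {m : ℕ} (h : ∑ j, r j = m) : natHeight r = m := by
  rw [natHeight, h, Nat.floor_natCast]

theorem cast_natHeight {v : ι → Fin d → ℤ} {r : ι → ℝ} (hr : r ∈ boxWeights v) :
    (natHeight r : ℝ) = ∑ j, r j := by
  obtain ⟨⟨-, z, hz⟩, h⟩ := hr
  have h0 : (0 : ℝ) ≤ ∑ j, r j := Finset.sum_nonneg fun j _ => (h j).1
  lift z to ℕ using by rw [hz] at h0; exact_mod_cast h0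
  rw [natHeight_eq_of_sum_eq (m := z) (by simpa using hz), hz]
  simp

theorem intCast_mem_integralWeights (v : ι → Fin d → ℤ) (m : ι → ℤ) :
    (fun j => (m j : ℝ)) ∈ integralWeights v :=
  ⟨fun i => ⟨∑ j, m j * v j i, by push_cast; rfl⟩, ∑ j, m j, by push_cast; rfl⟩

theorem fract_mem_boxWeights {v : ι → Fin d → ℤ} {r : ι → ℝ} (hr : r ∈ integralWeights v) :
    (fun j => Int.fract (r j)) ∈ boxWeights v :=
  ⟨(integralWeights v).sub_mem hr (intCast_mem_integralWeights v fun j => ⌊r j⌋),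
    fun _ => ⟨Int.fract_nonneg _, Int.fract_lt_one _⟩⟩

theorem zero_mem_boxWeights (v : ι → Fin d → ℤ) : (0 : ι → ℝ) ∈ boxWeights v :=
  ⟨zero_mem _, fun _ => ⟨le_rfl, zero_lt_one⟩⟩

theorem weights_eq_of_affineIndependent {v : ι → Fin d → ℤ}
    (hv : AffineIndependent ℝ fun j => toReal (v j)) {r s : ι → ℝ} (h1 : ∑ j, r j = ∑ j, s j)
    (h2 : ∀ i, ∑ j, r j * (v j i : ℝ) = ∑ j, s j * (v j i : ℝ)) : r = s := by
  ext j
  refine hv.eq_of_sum_eq_sum (s := Finset.univ) h1 ?_ j (Finset.mem_univ j)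
  ext i
  simpa [toReal] using h2 i

theorem boxWeights_finite {v : ι → Fin d → ℤ}
    (hv : AffineIndependent ℝ fun j => toReal (v j)) : (boxWeights v).Finite := by
  let B : Set ((Fin d → ℤ) × ℤ) :=
    Set.Icc (fun i => -∑ j, |v j i|) (fun i => ∑ j, |v j i|) ×ˢ Set.Icc 0 (Fintype.card ι : ℤ)
  have hB : B.Finite := (Set.finite_Icc _ _).prod (Set.finite_Icc _ _)
  let f : (ι → ℝ) → (Fin d → ℤ) × ℤ := fun r => (fun i => ⌊∑ j, r j * (v j i : ℝ)⌋, ⌊∑ j, r j⌋)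
  refine Set.Finite.of_finite_image (f := f) (hB.subset ?_) ?_
  · rintro _ ⟨r, ⟨⟨h1, z, hz⟩, h⟩, rfl⟩
    have hb : ∀ i, |∑ j, r j * (v j i : ℝ)| ≤ ((∑ j, |v j i| : ℤ) : ℝ) := fun i => by
      push_cast
      refine (Finset.abs_sum_le_sum_abs _ _).trans (Finset.sum_le_sum fun j _ => ?_)
      rw [abs_mul, abs_of_nonneg (h j).1]
      exact mul_le_of_le_one_left (abs_nonneg _) (h j).2.le
    refine ⟨⟨fun i => ?_, fun i => ?_⟩, ?_, ?_⟩
    · exact Int.le_floor.2 (by have := (abs_le.1 (hb i)).1; push_cast at this ⊢; exact this)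
    · have := (Int.floor_le (∑ j, r j * (v j i : ℝ))).trans (abs_le.1 (hb i)).2
      exact_mod_cast this
    · exact Int.floor_nonneg.2 (Finset.sum_nonneg fun j _ => (h j).1)
    · have : ∑ j, r j ≤ (Fintype.card ι : ℝ) := by
        simpa using Finset.sum_le_sum fun j (_ : j ∈ Finset.univ) => (h j).2.le
      exact_mod_cast (Int.floor_le _).trans this
  · rintro r ⟨⟨h1, z, hz⟩, -⟩ s ⟨⟨h1', z', hz'⟩, -⟩ hrs
    simp only [f, Prod.mk.injEq] at hrs
    refine weights_eq_of_affineIndependent hv ?_ fun i => ?_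
    · rw [hz, hz', Int.floor_intCast, Int.floor_intCast] at hrs
      rw [hz, hz', hrs.2]
    · have := congrFun hrs.1 i
      obtain ⟨y, hy⟩ := h1 i
      obtain ⟨y', hy'⟩ := h1' i
      simp only [hy, hy', Int.floor_intCast] at this
      rw [hy, hy', this]

open Classical in
theorem card_piAntidiag_univ (hcard : Fintype.card ι = d + 1) (m : ℕ) :
    (Finset.piAntidiag (Finset.univ : Finset ι) m).card = (m + d).choose d := by
  rw [← Finset.map_sym_eq_piAntidiag, Finset.card_map, Finset.sym_univ, Finset.card_univ,
    Sym.card_sym_eq_choose, hcard, show d + 1 + m - 1 = m + d by omega, Nat.choose_symm_add]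

/-- The Ehrhart function of a lattice simplex counts integral weights in the unit cube by height. -/
theorem latticeCount_simplex {v : ι → Fin d → ℤ}
    (hv : AffineIndependent ℝ fun j => toReal (v j)) (hcard : Fintype.card ι = d + 1) (hd : 1 ≤ d)
    {F : Finset (ι → ℝ)} (hF : (F : Set (ι → ℝ)) = boxWeights v) {n : ℕ} (hn : 1 ≤ n) :
    latticeCount (convexHull ℝ (Set.range fun j => toReal (v j))) n =
      ∑ r ∈ F, (n + d - natHeight r).choose d := by
  classical
  have hF' : ∀ r, r ∈ F ↔ r ∈ boxWeights v := fun r => by rw [← hF, Finset.mem_coe]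
  let S : Finset ((_ : ι → ℝ) × (ι → ℕ)) := F.sigma fun r =>
    if natHeight r ≤ n then Finset.piAntidiag Finset.univ (n - natHeight r) else ∅
  let f : ((_ : ι → ℝ) × (ι → ℕ)) → Fin d → ℤ :=
    fun p i => ⌊∑ j, (p.1 j + p.2 j) * (v j i : ℝ)⌋
  have hS : ∀ p, p ∈ S ↔ p.1 ∈ boxWeights v ∧ ∑ j, (p.1 j + p.2 j) = n := by
    rintro ⟨r, m⟩
    rw [Finset.mem_sigma, hF']
    refine and_congr_right fun hr => ?_
    simp only [Finset.sum_add_distrib, ← cast_natHeight hr]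
    split_ifs with h
    · simp only [Finset.mem_piAntidiag, Finset.mem_univ, implies_true, and_true]
      rw [← Nat.cast_sum, ← Nat.cast_add, Nat.cast_inj]
      change ∑ j, m j = _ ↔ _
      omega
    · rw [← Nat.cast_sum, ← Nat.cast_add, Nat.cast_inj]
      simp only [Finset.notMem_empty, false_iff]
      omega
  have hf : ∀ p ∈ S, ∀ i, ((f p i : ℤ) : ℝ) = ∑ j, (p.1 j + p.2 j) * (v j i : ℝ) := by
    intro p hp i
    obtain ⟨z, hz⟩ := ((integralWeights v).add_mem ((hS p).1 hp).1.1
      (intCast_mem_integralWeights v fun j => (p.2 j : ℤ))).1 i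
    simp only [Pi.add_apply, Int.cast_natCast] at hz
    simp only [f, hz, Int.floor_intCast]
  have hinj : Set.InjOn f S := by
    rintro p hp q hq hpq
    have hw : (fun j => p.1 j + p.2 j) = fun j => q.1 j + q.2 j := by
      refine weights_eq_of_affineIndependent hv ?_ fun i => ?_
      · rw [((hS p).1 hp).2, ((hS q).1 hq).2]
      · rw [← hf p hp, ← hf q hq, hpq]
    have h1 : p.1 = q.1 := by
      ext j
      have := congrArg Int.fract (congrFun hw j)
      rw [Int.fract_add_natCast, Int.fract_add_natCast] at this
      rwa [Int.fract_eq_self.2 (((hS p).1 hp).1.2 j),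
        Int.fract_eq_self.2 (((hS q).1 hq).1.2 j)] at this
    have h2 : p.2 = q.2 := by
      ext j
      have := congrFun hw j
      simpa [h1] using this
    exact Sigma.ext h1 (heq_of_eq h2)
  have himage : {x : Fin d → ℤ |
      toReal x ∈ (n : ℝ) • convexHull ℝ (Set.range fun j => toReal (v j))} = S.image f := by
    ext x
    rw [Set.mem_ofPred_eq, toReal_mem_smul_convexHull_range v hn, Finset.coe_image, Set.mem_image]
    constructor
    · rintro ⟨μ, h0, h1, h2⟩
      have hμ : μ ∈ integralWeights v := ⟨fun i => ⟨x i, h2 i⟩, n, by simpa using h1⟩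
      have hsum : (fun j => Int.fract (μ j) + (⌊μ j⌋₊ : ℝ)) = μ := by
        ext j
        rw [natCast_floor_eq_intCast_floor (h0 j), Int.fract_add_floor]
      have hmem : (⟨fun j => Int.fract (μ j), fun j => ⌊μ j⌋₊⟩ :
          (_ : ι → ℝ) × (ι → ℕ)) ∈ S :=
        (hS _).2 ⟨fract_mem_boxWeights hμ, by simpa only [← h1] using congrArg (∑ j, · j) hsum⟩
      refine ⟨_, hmem, ?_⟩
      ext i
      have := hf _ hmem i
      rw [← Int.cast_inj (α := ℝ), this, ← h2 i]
      exact Finset.sum_congr rfl fun j _ => by rw [congrFun hsum j]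
    · rintro ⟨p, hp, rfl⟩
      refine ⟨fun j => p.1 j + p.2 j, fun j => ?_, ((hS p).1 hp).2, fun i => (hf p hp i).symm⟩
      exact add_nonneg (((hS p).1 hp).1.2 j).1 (Nat.cast_nonneg _)
  rw [latticeCount, himage, Set.ncard_coe_finset, Finset.card_image_of_injOn hinj,
    Finset.card_sigma]
  refine Finset.sum_congr rfl fun r _ => ?_
  split_ifs with h
  · rw [card_piAntidiag_univ hcard, show n - natHeight r + d = n + d - natHeight r by omega]
  · rw [Finset.card_empty, Nat.choose_eq_zero_of_lt (by omega)]

end SimplexEhrhart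

section Obstruction

variable {ι : Type*} [Fintype ι] {d : ℕ}

/-- The integer vectors, as a subgroup of `integralWeights v`. -/
def integerWeights (v : ι → Fin d → ℤ) : AddSubgroup (integralWeights v) where
  carrier := {r | ∀ j, ∃ z : ℤ, (r : ι → ℝ) j = z}
  zero_mem' := fun _ => ⟨0, by simp⟩
  add_mem' := by
    intro r s hr hs j
    obtain ⟨y, hy⟩ := hr j
    obtain ⟨z, hz⟩ := hs j
    exact ⟨y + z, by simp [hy, hz]⟩
  neg_mem' := by
    intro r hr j
    obtain ⟨y, hy⟩ := hr j
    exact ⟨-y, by simp [hy]⟩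

theorem eq_of_sub_eq_intCast {x y : ℝ} (hx : 0 ≤ x ∧ x < 1) (hy : 0 ≤ y ∧ y < 1) {z : ℤ}
    (h : x - y = z) : x = y := by
  have h1 : (-1 : ℝ) < z := by linarith
  have h2 : (z : ℝ) < 1 := by linarith
  have : z = 0 := by
    have h1' : -1 < z := by exact_mod_cast h1
    have h2' : z < 1 := by exact_mod_cast h2
    omega
  subst this
  simpa [sub_eq_zero] using h

theorem card_quotient_integerWeights (v : ι → Fin d → ℤ) {F : Finset (ι → ℝ)}
    (hF : (F : Set (ι → ℝ)) = boxWeights v) :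
    Nat.card (integralWeights v ⧸ integerWeights v) = F.card := by
  have hF' : ∀ r, r ∈ F ↔ r ∈ boxWeights v := fun r => by rw [← hF, Finset.mem_coe]
  let f : F → integralWeights v ⧸ integerWeights v :=
    fun r => QuotientAddGroup.mk ⟨r, ((hF' r).1 r.2).1⟩
  have hf : Function.Bijective f := by
    constructor
    · intro r s hrs
      have := QuotientAddGroup.eq.1 hrs.symm
      ext j
      obtain ⟨z, hz⟩ := this j
      refine eq_of_sub_eq_intCast (((hF' r).1 r.2).2 j) (((hF' s).1 s.2).2 j) (z := z) ?_
      rw [← hz]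
      simp only [AddSubgroup.coe_add, AddSubgroup.coe_neg, Pi.add_apply, Pi.neg_apply]
      ring
    · intro q
      induction q using QuotientAddGroup.induction_on with
      | H r =>
        refine ⟨⟨_, (hF' _).2 (fract_mem_boxWeights r.2)⟩, QuotientAddGroup.eq.2 fun j => ?_⟩
        refine ⟨⌊(r : ι → ℝ) j⌋, ?_⟩
        simp only [AddSubgroup.coe_add, AddSubgroup.coe_neg, Pi.add_apply, Pi.neg_apply,
          Int.fract]
        ring
  rw [← Nat.card_congr (Equiv.ofBijective f hf)]
  simp

/-- When there is a prime number of box weights, all the nonzero ones have the same support. -/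
theorem apply_eq_zero_of_prime_card {v : ι → Fin d → ℤ} {F : Finset (ι → ℝ)}
    (hF : (F : Set (ι → ℝ)) = boxWeights v) (hp : F.card.Prime) {r s : ι → ℝ} (hr : r ∈ F)
    (hs : s ∈ F) (hr0 : r ≠ 0) {j : ι} (hj : r j = 0) : s j = 0 := by
  have hF' : ∀ r, r ∈ F ↔ r ∈ boxWeights v := fun r => by rw [← hF, Finset.mem_coe]
  have := Fact.mk hp
  obtain ⟨hrL, hr1⟩ := (hF' r).1 hr
  obtain ⟨hsL, hs1⟩ := (hF' s).1 hs
  have hne : (QuotientAddGroup.mk ⟨r, hrL⟩ : integralWeights v ⧸ integerWeights v) ≠ 0 := by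
    intro h
    apply hr0
    ext i
    obtain ⟨z, hz⟩ := (QuotientAddGroup.eq_zero_iff _).1 h i
    exact eq_of_sub_eq_intCast (hr1 i) ⟨le_rfl, zero_lt_one⟩ (z := z) (by simpa using hz)
  obtain ⟨m, hm⟩ := AddSubgroup.mem_zmultiples_iff.1 (mem_zmultiples_of_prime_card
    (card_quotient_integerWeights v hF) hne
    (g' := QuotientAddGroup.mk (⟨s, hsL⟩ : integralWeights v)))
  rw [← QuotientAddGroup.mk_zsmul] at hm
  obtain ⟨z, hz⟩ := QuotientAddGroup.eq.1 hm j
  refine eq_of_sub_eq_intCast (hs1 j) ⟨le_rfl, zero_lt_one⟩ (z := z) ?_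
  simpa [hj] using hz

/-- The inverse of a box weight modulo integer vectors. -/
noncomputable def boxNeg (r : ι → ℝ) : ι → ℝ := fun j => Int.fract (-r j)

theorem boxNeg_mem {v : ι → Fin d → ℤ} {r : ι → ℝ} (hr : r ∈ boxWeights v) :
    boxNeg r ∈ boxWeights v :=
  fract_mem_boxWeights ((integralWeights v).neg_mem hr.1)

theorem add_boxNeg_apply {v : ι → Fin d → ℤ} {r : ι → ℝ} (hr : r ∈ boxWeights v) (j : ι) :
    r j + boxNeg r j = if r j = 0 then 0 else 1 := by
  split_ifs with h
  · simp [boxNeg, h]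
  · have hne : Int.fract (r j) ≠ 0 := by rwa [Int.fract_eq_self.2 (hr.2 j)]
    rw [boxNeg, Int.fract_neg hne, Int.fract_eq_self.2 (hr.2 j)]
    ring

theorem boxNeg_boxNeg {v : ι → Fin d → ℤ} {r : ι → ℝ} (hr : r ∈ boxWeights v) :
    boxNeg (boxNeg r) = r := by
  ext j
  have h1 := add_boxNeg_apply hr j
  have h2 := add_boxNeg_apply (boxNeg_mem hr) j
  have := (hr.2 j).2
  split_ifs at h1 h2 with hr0 hn0 hn0
  · linarith
  · exact absurd (by linarith) hn0
  · linarith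
  · linarith

theorem boxNeg_ne_zero {v : ι → Fin d → ℤ} {r : ι → ℝ} (hr : r ∈ boxWeights v) (h0 : r ≠ 0) :
    boxNeg r ≠ 0 := by
  intro h
  apply h0
  rw [← boxNeg_boxNeg hr, h]
  ext j
  simp [boxNeg]

theorem natHeight_eq_zero_iff {v : ι → Fin d → ℤ} {r : ι → ℝ} (hr : r ∈ boxWeights v) :
    natHeight r = 0 ↔ r = 0 := by
  constructor
  · intro h
    have h' := cast_natHeight hr
    rw [h, Nat.cast_zero, eq_comm, Finset.sum_eq_zero_iff_of_nonneg fun j _ => (hr.2 j).1] at h'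
    ext j
    exact h' j (Finset.mem_univ j)
  · rintro rfl
    exact natHeight_eq_of_sum_eq (by simp)

open Classical in
theorem natHeight_add_natHeight_boxNeg {v : ι → Fin d → ℤ} {r : ι → ℝ} (hr : r ∈ boxWeights v) :
    natHeight r + natHeight (boxNeg r) = (Finset.univ.filter fun j => r j ≠ 0).card := by
  rw [← Nat.cast_inj (R := ℝ), Nat.cast_add, cast_natHeight hr, cast_natHeight (boxNeg_mem hr),
    ← Finset.sum_add_distrib, Finset.sum_congr rfl fun j _ => add_boxNeg_apply hr j,
    Finset.card_filter]
  push_cast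
  exact Finset.sum_congr rfl fun j _ => by split_ifs <;> simp_all

/-- With exactly seven box weights, of height at most `k`, height `k` cannot occur four times
if height `k - 1` occurs. -/
theorem not_seven_boxWeights {v : ι → Fin d → ℤ} {F : Finset (ι → ℝ)}
    (hF : (F : Set (ι → ℝ)) = boxWeights v) (h7 : F.card = 7) {k : ℕ} (hk : 2 ≤ k)
    (hle : ∀ r ∈ F, natHeight r ≤ k) (h4 : 4 ≤ (F.filter fun r => natHeight r = k).card)
    (h1 : 1 ≤ (F.filter fun r => natHeight r = k - 1).card) : False := by
  classical
  have hF' : ∀ r, r ∈ F ↔ r ∈ boxWeights v := fun r => by rw [← hF, Finset.mem_coe]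
  have hp : F.card.Prime := by rw [h7]; norm_num
  set K := F.filter fun r => natHeight r = k with hK
  have hKF : ∀ r ∈ K, r ∈ boxWeights v ∧ r ≠ 0 := fun r hr => by
    have hm := (hF' r).1 (Finset.mem_filter.1 hr).1
    refine ⟨hm, fun h => ?_⟩
    have := (natHeight_eq_zero_iff hm).2 h
    have := (Finset.mem_filter.1 hr).2
    omega
  have hinj : Set.InjOn boxNeg (K : Set (ι → ℝ)) := fun r hr s hs hrs => by
    rw [← boxNeg_boxNeg (hKF r hr).1, hrs, boxNeg_boxNeg (hKF s hs).1]
  have hKc : (K.image boxNeg).card = K.card := Finset.card_image_of_injOn hinj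
  have hsub : K ∪ K.image boxNeg ⊆ F.erase 0 := by
    intro r hr
    rw [Finset.mem_union, Finset.mem_image] at hr
    rcases hr with hr | ⟨s, hs, rfl⟩
    · exact Finset.mem_erase.2 ⟨(hKF r hr).2, (hF' r).2 (hKF r hr).1⟩
    · exact Finset.mem_erase.2
        ⟨boxNeg_ne_zero (hKF s hs).1 (hKF s hs).2, (hF' _).2 (boxNeg_mem (hKF s hs).1)⟩
  have hcard := Finset.card_le_card hsub
  rw [Finset.card_erase_of_mem ((hF' 0).2 (zero_mem_boxWeights v)), h7] at hcard
  have hinter := Finset.card_union_add_card_inter K (K.image boxNeg)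
  obtain ⟨s, hs⟩ : (K ∩ K.image boxNeg).Nonempty := Finset.card_pos.1 (by omega)
  obtain ⟨hsK, hs'⟩ := Finset.mem_inter.1 hs
  obtain ⟨r, hrK, hrs⟩ := Finset.mem_image.1 hs'
  obtain ⟨t, ht⟩ := Finset.card_pos.1 h1
  obtain ⟨htF, htk⟩ := Finset.mem_filter.1 ht
  have htb := (hF' t).1 htF
  have ht0 : t ≠ 0 := fun h => by
    have := (natHeight_eq_zero_iff htb).2 h
    omega
  have e1 := natHeight_add_natHeight_boxNeg (hKF r hrK).1
  have e2 := natHeight_add_natHeight_boxNeg htb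
  rw [hrs, (Finset.mem_filter.1 hrK).2, (Finset.mem_filter.1 hsK).2] at e1
  have hsupp : (Finset.univ.filter fun j => r j ≠ 0) ⊆ Finset.univ.filter fun j => t j ≠ 0 := by
    intro j hj
    simp only [Finset.mem_filter, Finset.mem_univ, true_and] at hj ⊢
    exact fun h => hj (apply_eq_zero_of_prime_card hF hp htF ((hF' r).2 (hKF r hrK).1) ht0 h)
  have := Finset.card_le_card hsupp
  have := hle _ ((hF' _).2 (boxNeg_mem htb))
  omega

/-- The coefficients of a function in the binomial basis `C(n + e - i, e)` are determined by its
values at positive integers, together with the constant coefficient. -/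
theorem binomial_coeff_unique {A B : ℕ → ℕ} {e M N : ℕ} (he : 1 ≤ e)
    (hA : ∀ i, M ≤ i → A i = 0) (hB : ∀ i, N ≤ i → B i = 0) (h0 : A 0 = B 0)
    (h : ∀ n, 1 ≤ n → ∑ i ∈ Finset.range M, A i * (n + e - i).choose e =
      ∑ i ∈ Finset.range N, B i * (n + e - i).choose e) : A = B := by
  have key : ∀ (A : ℕ → ℕ) (M n : ℕ), (∀ i, M ≤ i → A i = 0) →
      ∑ i ∈ Finset.range M, A i * (n + e - i).choose e =
        ∑ i ∈ Finset.range (n + 1), A i * (n + e - i).choose e := by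
    intro A M n hA
    rcases le_total M (n + 1) with hM | hM
    · refine Finset.sum_subset (Finset.range_mono hM) fun i _ hi => ?_
      rw [hA i (by simpa using hi), zero_mul]
    · refine (Finset.sum_subset (Finset.range_mono hM) fun i _ hi => ?_).symm
      rw [Finset.mem_range, not_lt] at hi
      rw [Nat.choose_eq_zero_of_lt (by omega), mul_zero]
  ext n
  induction n using Nat.strong_induction_on with
  | _ n ih =>
    rcases Nat.eq_zero_or_pos n with rfl | hn
    · exact h0
    · have hn' := h n hn
      rw [key A M n hA, key B N n hB, Finset.sum_range_succ, Finset.sum_range_succ,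
        Finset.sum_congr rfl fun i hi => by rw [ih i (Finset.mem_range.1 hi)]] at hn'
      simpa using hn'

/-- A full-dimensional lattice polytope in `ℝ^e` with `e + 1` lattice points is a simplex. -/
theorem exists_simplex_of_latticeCount_one {e : ℕ} {Q : Set (Fin e → ℝ)}
    (hQ : IsFullDimLatticePolytope Q) (h1 : latticeCount Q 1 = e + 1) :
    ∃ V : Finset (Fin e → ℤ), V.card = e + 1 ∧
      Q = convexHull ℝ (Set.range fun x : V => toReal (x : Fin e → ℤ)) ∧
      AffineIndependent ℝ fun x : V => toReal (x : Fin e → ℤ) := by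
  obtain ⟨V, rfl, hspan⟩ := hQ
  have hrange : toReal '' (V : Set (Fin e → ℤ)) =
      Set.range fun x : V => toReal (x : Fin e → ℤ) := by
    ext y
    simp
  rw [affineSpan_convexHull, hrange] at hspan
  have hle : V.card ≤ e + 1 := by
    rw [latticeCount, Nat.cast_one, one_smul] at h1
    rw [← h1, ← Set.ncard_coe_finset]
    refine Set.ncard_le_ncard (fun x hx => ?_) (Set.finite_of_ncard_pos (by omega))
    exact subset_convexHull ℝ _ ⟨x, hx, rfl⟩
  have hfin : Module.finrank ℝ
      (vectorSpan ℝ (Set.range fun x : V => toReal (x : Fin e → ℤ))) = e := by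
    rw [← direction_affineSpan, hspan, AffineSubspace.direction_top, finrank_top]
    simp
  have hne : Nonempty V := by
    by_contra hemp
    rw [not_nonempty_iff] at hemp
    rw [Set.range_eq_empty, AffineSubspace.span_empty] at hspan
    exact AffineSubspace.bot_ne_top ℝ (Fin e → ℝ) (Fin e → ℝ) hspan
  have hge := finrank_vectorSpan_range_add_one_le ℝ fun x : V => toReal (x : Fin e → ℤ)
  rw [hfin, Fintype.card_coe] at hge
  have hcard : V.card = e + 1 := le_antisymm hle hge
  refine ⟨V, hcard, by rw [hrange], ?_⟩
  rw [affineIndependent_iff_finrank_vectorSpan_eq ℝ _ (n := e) (by rw [Fintype.card_coe, hcard])]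
  exact hfin

/-- A numerical obstruction to being the h*-vector of a lattice polytope. -/
theorem not_exists_polytope {h : ℕ → ℕ} {k : ℕ} (hk : 3 ≤ k) (h0 : h 0 = 1) (h1 : h 1 = 0)
    (h7 : ∑ i ∈ Finset.range (k + 1), h i = 7) (h4 : 4 ≤ h k) (hk1 : 1 ≤ h (k - 1)) :
    ¬ ∃ (e : ℕ) (Q : Set (Fin e → ℝ)), 1 ≤ e ∧ IsFullDimLatticePolytope Q ∧
      ∀ n : ℕ, 1 ≤ n →
        latticeCount Q n = ∑ i ∈ Finset.range (k + 1), h i * Nat.choose (n + e - i) e := by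
  classical
  rintro ⟨e, Q, he, hQ, hcount⟩
  have hone : latticeCount Q 1 = e + 1 := by
    rw [hcount 1 le_rfl, Finset.sum_eq_single_of_mem 0 (by simp), h0]
    · simp [add_comm 1 e]
    · intro i _ hi
      rcases eq_or_ne i 1 with rfl | hi1
      · rw [h1, zero_mul]
      · rw [Nat.choose_eq_zero_of_lt (by omega), mul_zero]
  obtain ⟨V, hV, rfl, hind⟩ := exists_simplex_of_latticeCount_one hQ hone
  set v : V → Fin e → ℤ := fun x => x with hv
  obtain ⟨F, hF⟩ : ∃ F : Finset (V → ℝ), (F : Set (V → ℝ)) = boxWeights v :=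
    ⟨(boxWeights_finite (v := v) hind).toFinset, by simp⟩
  have hF' : ∀ r, r ∈ F ↔ r ∈ boxWeights v := fun r => by rw [← hF, Finset.mem_coe]
  let H : ℕ → ℕ := fun i => (F.filter fun r => natHeight r = i).card
  let M := F.sup natHeight + 1
  have hM : ∀ r ∈ F, natHeight r ∈ Finset.range M := fun r hr => by
    have := Finset.le_sup (f := natHeight) hr
    exact Finset.mem_range.2 (by omega)
  have hH0 : H 0 = 1 := by
    refine Finset.card_eq_one.2 ⟨0, ?_⟩
    ext r
    rw [Finset.mem_filter, Finset.mem_singleton, hF']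
    exact ⟨fun h => (natHeight_eq_zero_iff h.1).1 h.2,
      fun h => h ▸ ⟨zero_mem_boxWeights v, (natHeight_eq_zero_iff (zero_mem_boxWeights v)).2 rfl⟩⟩
  have hH : H = fun i => if i < k + 1 then h i else 0 := by
    refine binomial_coeff_unique (M := M) (N := k + 1) he (fun i hi => ?_) (fun i hi => ?_) ?_ ?_
    · refine Finset.card_eq_zero.2 (Finset.filter_eq_empty_iff.2 fun r hr h => ?_)
      have := Finset.mem_range.1 (hM r hr)
      omega
    · exact if_neg (by omega)
    · simp [hH0, h0]
    · intro n hn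
      have hs := latticeCount_simplex (v := v) hind (by rw [Fintype.card_coe, hV]) he hF hn
      rw [hcount n hn, ← Finset.sum_fiberwise_of_maps_to hM] at hs
      have hfib : ∀ i ∈ Finset.range M, H i * (n + e - i).choose e =
          ∑ r ∈ F with natHeight r = i, (n + e - natHeight r).choose e := fun i _ => by
        rw [← smul_eq_mul, ← Finset.sum_const]
        exact Finset.sum_congr rfl fun r hr => by rw [(Finset.mem_filter.1 hr).2]
      rw [Finset.sum_congr rfl hfib, ← hs]
      exact Finset.sum_congr rfl fun i hi => by rw [if_pos (Finset.mem_range.1 hi)]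
  have hle : ∀ r ∈ F, natHeight r ≤ k := fun r hr => by
    by_contra hlt
    have hz := congrFun hH (natHeight r)
    rw [if_neg (by omega)] at hz
    exact Finset.filter_eq_empty_iff.1 (Finset.card_eq_zero.1 hz) hr rfl
  have hcard : F.card = 7 := by
    rw [Finset.card_eq_sum_card_fiberwise (f := natHeight) (t := Finset.range (k + 1))
      fun r hr => Finset.mem_coe.2 (Finset.mem_range.2 (Nat.lt_succ_of_le (hle r hr))), ← h7]
    refine Finset.sum_congr rfl fun i hi => ?_
    exact (congrFun hH i).trans (if_pos (Finset.mem_range.1 hi))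
  refine not_seven_boxWeights hF hcard (k := k) (by omega) hle ?_ ?_
  · exact h4.trans_eq ((congrFun hH k).trans (if_pos (by omega))).symm
  · exact hk1.trans_eq ((congrFun hH (k - 1)).trans (if_pos (by omega))).symm

end Obstruction

section HalfIntegralSimplex

variable {ι : Type*} [Fintype ι] {d : ℕ}

/-- The vertices of a simplex whose box weights are generated by the halves of three integer
vectors `α`, `β`, `γ`, where `p`, `q`, `s` are coordinates on which these are the unit vectors. -/
def halfVertices [DecidableEq ι] (α β γ : ι → ℤ) (p q s : ι) (ρ : Fin d → ι)
    (t : ι) (l : Fin d) : ℤ :=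
  (if ρ l = t then 1 else 0) + α (ρ l) * (if p = t then 1 else 0) +
    β (ρ l) * (if q = t then 1 else 0) + γ (ρ l) * (if s = t then 1 else 0)

/-- The linear forms whose integrality characterises the integral weights of `halfVertices`. -/
def halfForm (α β γ : ι → ℤ) (p q s : ι) (r : ι → ℝ) (i : ι) : ℝ :=
  r i + α i * r p + β i * r q + γ i * r s

theorem sum_mul_halfVertices [DecidableEq ι] (α β γ : ι → ℤ) (p q s : ι) (ρ : Fin d → ι) (r : ι → ℝ)
    (l : Fin d) :
    ∑ t, r t * (halfVertices α β γ p q s ρ t l : ℝ) = halfForm α β γ p q s r (ρ l) := by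
  simp only [halfVertices, halfForm]
  push_cast
  simp only [mul_add, Finset.sum_add_distrib, mul_ite, mul_one, mul_zero, Finset.sum_ite_eq,
    Finset.mem_univ, if_true]
  ring

/-- Unit vectors at the pivots, and even coordinate sums. -/
structure IsHalfSystem (α β γ : ι → ℤ) (p q s : ι) : Prop where
  left : α p = 1 ∧ β p = 0 ∧ γ p = 0
  middle : α q = 0 ∧ β q = 1 ∧ γ q = 0
  right : α s = 0 ∧ β s = 0 ∧ γ s = 1
  even_left : Even (∑ i, α i)
  even_middle : Even (∑ i, β i)
  even_right : Even (∑ i, γ i)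

variable {α β γ : ι → ℤ} {p q s : ι}

theorem halfForm_pivots (h : IsHalfSystem α β γ p q s) (r : ι → ℝ) :
    halfForm α β γ p q s r p = 2 * r p ∧ halfForm α β γ p q s r q = 2 * r q ∧
      halfForm α β γ p q s r s = 2 * r s := by
  obtain ⟨a1, a2, a3⟩ := h.left
  obtain ⟨b1, b2, b3⟩ := h.middle
  obtain ⟨c1, c2, c3⟩ := h.right
  refine ⟨?_, ?_, ?_⟩ <;> simp only [halfForm, a1, a2, a3, b1, b2, b3, c1, c2, c3] <;>
    push_cast <;> ring

theorem sum_halfForm (r : ι → ℝ) :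
    ∑ i, halfForm α β γ p q s r i = ∑ i, r i + ((∑ i, α i : ℤ) : ℝ) * r p +
      ((∑ i, β i : ℤ) : ℝ) * r q + ((∑ i, γ i : ℤ) : ℝ) * r s := by
  push_cast
  simp only [halfForm, Finset.sum_add_distrib, Finset.sum_mul]

theorem mem_integralWeights_halfVertices [DecidableEq ι] (h : IsHalfSystem α β γ p q s) {o : ι}
    (hp : p ≠ o) (hq : q ≠ o) (hs : s ≠ o) (ρ : Fin d ≃ {i // i ≠ o}) (r : ι → ℝ) :
    r ∈ integralWeights (halfVertices α β γ p q s fun l => (ρ l : ι)) ↔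
      ∀ i, ∃ z : ℤ, halfForm α β γ p q s r i = z := by
  let Z : AddSubgroup ℝ := (Int.castAddHom ℝ).range
  have hZ : ∀ x : ℝ, (∃ z : ℤ, x = z) ↔ x ∈ Z := fun x =>
    ⟨fun ⟨z, hz⟩ => ⟨z, hz.symm⟩, fun ⟨z, hz⟩ => ⟨z, hz.symm⟩⟩
  have hdiff : (∀ i, i ≠ o → halfForm α β γ p q s r i ∈ Z) →
      ∑ i, halfForm α β γ p q s r i - ∑ i, r i ∈ Z := by
    intro hi
    obtain ⟨fp, fq, fs⟩ := halfForm_pivots h r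
    obtain ⟨x, hx⟩ := h.even_left
    obtain ⟨y, hy⟩ := h.even_middle
    obtain ⟨z, hz⟩ := h.even_right
    have := Z.add_mem (Z.add_mem (Z.zsmul_mem (hi p hp) x) (Z.zsmul_mem (hi q hq) y))
      (Z.zsmul_mem (hi s hs) z)
    convert this using 1
    rw [sum_halfForm, fp, fq, fs, hx, hy, hz]
    simp only [zsmul_eq_mul]
    push_cast
    ring
  change ((∀ l, ∃ z : ℤ, _) ∧ ∃ z : ℤ, _) ↔ _
  simp only [sum_mul_halfVertices, hZ]
  constructor
  · rintro ⟨h1, h2⟩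
    have h1' : ∀ i, i ≠ o → halfForm α β γ p q s r i ∈ Z := fun i hi => by
      simpa using h1 (ρ.symm ⟨i, hi⟩)
    intro i
    rcases eq_or_ne i o with rfl | hi
    · have h3 := Z.add_mem (hdiff h1') h2
      rw [sub_add_cancel, ← Finset.add_sum_erase _ _ (Finset.mem_univ i)] at h3
      refine (Z.add_mem_cancel_right (Z.sum_mem fun t ht => ?_)).1 h3
      exact h1' t (Finset.ne_of_mem_erase ht)
    · exact h1' i hi
  · intro hi
    refine ⟨fun l => hi _, ?_⟩
    have := Z.sub_mem (Z.sum_mem fun i (_ : i ∈ Finset.univ) => hi i) (hdiff fun i _ => hi i)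
    rwa [sub_sub_cancel] at this

theorem affineIndependent_halfVertices [DecidableEq ι] (h : IsHalfSystem α β γ p q s) {o : ι}
    (hp : p ≠ o) (hq : q ≠ o) (hs : s ≠ o) (ρ : Fin d ≃ {i // i ≠ o}) :
    AffineIndependent ℝ
      fun t => toReal (halfVertices α β γ p q s (fun l => (ρ l : ι)) t) := by
  rw [affineIndependent_iff_of_fintype]
  intro w hw0 hw
  rw [Finset.univ.weightedVSub_eq_linear_combination hw0] at hw
  have hi : ∀ i, i ≠ o → halfForm α β γ p q s w i = 0 := fun i hi => by
    have := congrFun hw (ρ.symm ⟨i, hi⟩)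
    simp only [Finset.sum_apply, Pi.smul_apply, smul_eq_mul, toReal, Pi.zero_apply] at this
    rw [sum_mul_halfVertices] at this
    simpa using this
  obtain ⟨fp, fq, fs⟩ := halfForm_pivots h w
  have hwp : w p = 0 := by linarith [hi p hp]
  have hwq : w q = 0 := by linarith [hi q hq]
  have hws : w s = 0 := by linarith [hi s hs]
  have hwi : ∀ i, i ≠ o → w i = 0 := fun i ho => by
    simpa [halfForm, hwp, hwq, hws] using hi i ho
  intro i
  rcases eq_or_ne i o with rfl | ho
  · rwa [Finset.sum_eq_single i (fun t _ ht => hwi t ht) (by simp)] at hw0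
  · exact hwi i ho

/-- The box weight congruent to half of a sum of some of the vectors `α`, `β`, `γ`. -/
noncomputable def halfWeight (α β γ : ι → ℤ) (x : Bool × Bool × Bool) (i : ι) : ℝ :=
  Int.fract (((α i * x.1.toNat + β i * x.2.1.toNat + γ i * x.2.2.toNat : ℤ) : ℝ) / 2)

theorem fract_toNat_half (x : Bool) : Int.fract ((x.toNat : ℝ) / 2) = x.toNat / 2 := by
  cases x <;> norm_num

theorem halfWeight_pivots (h : IsHalfSystem α β γ p q s) (x : Bool × Bool × Bool) :
    halfWeight α β γ x p = x.1.toNat / 2 ∧ halfWeight α β γ x q = x.2.1.toNat / 2 ∧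
      halfWeight α β γ x s = x.2.2.toNat / 2 := by
  obtain ⟨a1, a2, a3⟩ := h.left
  obtain ⟨b1, b2, b3⟩ := h.middle
  obtain ⟨c1, c2, c3⟩ := h.right
  refine ⟨?_, ?_, ?_⟩ <;> simp [halfWeight, a1, a2, a3, b1, b2, b3, c1, c2, c3, fract_toNat_half]

theorem halfWeight_injective (h : IsHalfSystem α β γ p q s) :
    Function.Injective (halfWeight α β γ) := by
  have hb : ∀ x y : Bool, (x.toNat : ℝ) / 2 = y.toNat / 2 → x = y := by
    intro x y hxy
    cases x <;> cases y <;> simp_all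
  intro x y hxy
  obtain ⟨x1, x2, x3⟩ := halfWeight_pivots h x
  obtain ⟨y1, y2, y3⟩ := halfWeight_pivots h y
  rw [hxy] at x1 x2 x3
  exact Prod.ext (hb _ _ (x1.symm.trans y1))
    (Prod.ext (hb _ _ (x2.symm.trans y2)) (hb _ _ (x3.symm.trans y3)))

theorem exists_toNat_half {x : ℝ} (h0 : 0 ≤ x ∧ x < 1) (h : ∃ z : ℤ, 2 * x = z) :
    ∃ b : Bool, x = b.toNat / 2 := by
  obtain ⟨z, hz⟩ := h
  have h1 : (-1 : ℝ) < z := by linarith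
  have h2 : (z : ℝ) < 2 := by linarith
  have h1' : -1 < z := by exact_mod_cast h1
  have h2' : z < 2 := by exact_mod_cast h2
  obtain rfl | rfl : z = 0 ∨ z = 1 := by omega
  · exact ⟨false, by simpa using hz⟩
  · exact ⟨true, by norm_num at hz ⊢; linarith⟩

theorem boxWeights_halfVertices [DecidableEq ι] (h : IsHalfSystem α β γ p q s) {o : ι}
    (hp : p ≠ o) (hq : q ≠ o) (hs : s ≠ o) (ρ : Fin d ≃ {i // i ≠ o}) :
    boxWeights (halfVertices α β γ p q s fun l => (ρ l : ι)) = Set.range (halfWeight α β γ) := by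
  ext r
  rw [boxWeights, Set.mem_ofPred_eq, mem_integralWeights_halfVertices h hp hq hs ρ]
  constructor
  · rintro ⟨hint, hbox⟩
    obtain ⟨fp, fq, fs⟩ := halfForm_pivots h r
    obtain ⟨x, hx⟩ := exists_toNat_half (hbox p) (fp ▸ hint p)
    obtain ⟨y, hy⟩ := exists_toNat_half (hbox q) (fq ▸ hint q)
    obtain ⟨z, hz⟩ := exists_toNat_half (hbox s) (fs ▸ hint s)
    refine ⟨(x, y, z), ?_⟩
    ext i
    obtain ⟨m, hm⟩ := hint i
    rw [halfForm, hx, hy, hz] at hm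
    rw [← Int.fract_eq_self.2 (hbox i), halfWeight, Int.fract_eq_fract]
    refine ⟨α i * x.toNat + β i * y.toNat + γ i * z.toNat - m, ?_⟩
    push_cast
    linarith
  · rintro ⟨x, rfl⟩
    refine ⟨fun i => ?_, fun j => ⟨Int.fract_nonneg _, Int.fract_lt_one _⟩⟩
    obtain ⟨x1, x2, x3⟩ := halfWeight_pivots h x
    rw [halfForm, x1, x2, x3, halfWeight, Int.fract]
    set f := ⌊((α i * x.1.toNat + β i * x.2.1.toNat + γ i * x.2.2.toNat : ℤ) : ℝ) / 2⌋
    refine ⟨α i * x.1.toNat + β i * x.2.1.toNat + γ i * x.2.2.toNat - f, ?_⟩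
    push_cast
    ring

end HalfIntegralSimplex

section Blocks

variable (a b c : ℕ)

/-- Coordinates in two pairs of blocks of equal sizes and a fifth block. -/
abbrev Blocks := (Fin a ⊕ Fin a) ⊕ (Fin b ⊕ Fin b) ⊕ Fin c

/-- The indicator of the first pair of blocks. -/
def blockLeft : Blocks a b c → ℤ := Sum.elim 1 0

/-- The indicator of the second pair of blocks. -/
def blockMiddle : Blocks a b c → ℤ := Sum.elim 0 (Sum.elim 1 0)

/-- The indicator of one block of each pair, and of the fifth block. -/
def blockRight : Blocks a b c → ℤ := Sum.elim (Sum.elim 1 0) (Sum.elim (Sum.elim 1 0) 1)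

variable {a b c}

theorem isHalfSystem_blocks (ha : 0 < a) (hb : 0 < b) (hc : 0 < c) (heven : Even (a + b + c)) :
    IsHalfSystem (blockLeft a b c) (blockMiddle a b c) (blockRight a b c)
      (Sum.inl (Sum.inr ⟨0, ha⟩)) (Sum.inr (Sum.inl (Sum.inr ⟨0, hb⟩)))
      (Sum.inr (Sum.inr ⟨0, hc⟩)) where
  left := by simp [blockLeft, blockMiddle, blockRight]
  middle := by simp [blockLeft, blockMiddle, blockRight]
  right := by simp [blockLeft, blockMiddle, blockRight]
  even_left := by simp [blockLeft]
  even_middle := by simp [blockMiddle]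
  even_right := by
    obtain ⟨m, hm⟩ := heven
    exact ⟨m, by simp [blockRight]; omega⟩

theorem sum_halfWeight_blocks (x : Bool × Bool × Bool) :
    ∑ i, halfWeight (blockLeft a b c) (blockMiddle a b c) (blockRight a b c) x i =
      match x with
      | (false, false, false) => 0
      | (true, false, false) => (a : ℝ)
      | (false, true, false) => (b : ℝ)
      | (true, true, false) => (a : ℝ) + b
      | (_, _, true) => ((a : ℝ) + b + c) / 2 := by
  have h2 : Int.fract ((2 : ℝ)⁻¹) = 2⁻¹ := by norm_num
  rcases x with ⟨_ | _, _ | _, _ | _⟩ <;>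
    simp [halfWeight, blockLeft, blockMiddle, blockRight, h2] <;> ring

end Blocks

/-- for `k ≥ 3` and `k+1 ≤ j ≤ 2k-1`, there is a lattice simplex whose
h*-vector `(h₀, …, h_d)` satisfies `hᵢ = 0` for `k+1 ≤ i ≤ 2k-1`, `i ≠ j`, has `h_j ≠ 0`,
and such that `(h₀, …, h_k)` does not satisfy the degree `k` condition. -/
theorem stmt11 (k j : ℕ) (hk : 3 ≤ k) (hj1 : k + 1 ≤ j) (hj2 : j ≤ 2 * k - 1) :
    ∃ d : ℕ, 1 ≤ d ∧ ∃ v : Fin (d + 1) → Fin d → ℤ, ∃ h : ℕ → ℕ,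
      AffineIndependent ℝ (fun jj => toReal (v jj)) ∧
      h 0 = 1 ∧
      (∀ n : ℕ, 1 ≤ n →
        latticeCount (convexHull ℝ (Set.range fun jj => toReal (v jj))) n =
          ∑ i ∈ Finset.range (d + 1), h i * Nat.choose (n + d - i) d) ∧
      (∀ i : ℕ, k + 1 ≤ i → i ≤ 2 * k - 1 → i ≠ j → h i = 0) ∧
      h j ≠ 0 ∧
      ¬ ∃ (e : ℕ) (Q : Set (Fin e → ℝ)), 1 ≤ e ∧ IsFullDimLatticePolytope Q ∧
        ∀ n : ℕ, 1 ≤ n →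
          latticeCount Q n = ∑ i ∈ Finset.range (k + 1), h i * Nat.choose (n + e - i) e := by
  classical
  obtain ⟨a, b, c, ha, hab, hb, hc⟩ :
      ∃ a b c, 2 ≤ a ∧ a + b = j ∧ b + 1 = k ∧ c + j = 2 * k :=
    ⟨j - k + 1, k - 1, 2 * k - j, by omega, by omega, by omega, by omega⟩
  obtain ⟨d, hd⟩ : ∃ d, d + 1 = 2 * k + j := ⟨2 * k + j - 1, by omega⟩
  have hcard : Fintype.card (Blocks a b c) = d + 1 := by simp; omega
  have hsys := isHalfSystem_blocks (a := a) (b := b) (c := c) (by omega) (by omega) (by omega)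
    ⟨k, by omega⟩
  let o : Blocks a b c := Sum.inl (Sum.inl ⟨0, by omega⟩)
  let ρ : Fin d ≃ {i // i ≠ o} := (Fintype.equivFinOfCardEq (by
    rw [Fintype.card_subtype_compl, hcard, Fintype.card_subtype_eq, Nat.add_sub_cancel])).symm
  let ε : Fin (d + 1) ≃ Blocks a b c := (Fintype.equivFinOfCardEq hcard).symm
  have hind := affineIndependent_halfVertices hsys (o := o) (by simp [o]) (by simp [o])
    (by simp [o]) ρ
  have hbox := boxWeights_halfVertices hsys (o := o) (by simp [o]) (by simp [o])
    (by simp [o]) ρ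
  set v := halfVertices (blockLeft a b c) (blockMiddle a b c) (blockRight a b c)
    (Sum.inl (Sum.inr ⟨0, by omega⟩)) (Sum.inr (Sum.inl (Sum.inr ⟨0, by omega⟩)))
    (Sum.inr (Sum.inr ⟨0, by omega⟩)) (fun l => (ρ l : Blocks a b c))
  let h : ℕ → ℕ := fun i => (if i = 0 then 1 else 0) + (if i = a then 1 else 0) +
    (if i = b then 1 else 0) + (if i = k then 4 else 0) + (if i = j then 1 else 0)
  refine ⟨d, by omega, fun jj => v (ε jj), h, hind.comp_embedding ε.toEmbedding, ?_, ?_, ?_, ?_,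
    not_exists_polytope hk ?_ ?_ ?_ ?_ ?_⟩
  · simp only [h]
    split_ifs <;> omega
  · intro n hn
    have hrange : (Set.range fun jj => toReal (v (ε jj))) = Set.range fun t => toReal (v t) :=
      ε.surjective.range_comp fun t => toReal (v t)
    have hF : ((Finset.univ.image (halfWeight (blockLeft a b c) (blockMiddle a b c)
        (blockRight a b c)) : Finset (Blocks a b c → ℝ)) : Set (Blocks a b c → ℝ)) =
        boxWeights v := by
      rw [hbox, Finset.coe_image, Finset.coe_univ, Set.image_univ]
    have hheight : ∀ x, natHeight (halfWeight (blockLeft a b c) (blockMiddle a b c)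
        (blockRight a b c) x) = match x with
          | (false, false, false) => 0
          | (true, false, false) => a
          | (false, true, false) => b
          | (true, true, false) => j
          | (_, _, true) => k := by
      have hk' : (a : ℝ) + b + c = 2 * k := by
        have : a + b + c = 2 * k := by omega
        exact_mod_cast this
      intro x
      apply natHeight_eq_of_sum_eq
      rw [sum_halfWeight_blocks]
      rcases x with ⟨_ | _, _ | _, _ | _⟩ <;>
        simp [hk', ← hab]
    rw [hrange, latticeCount_simplex hind hcard (by omega) hF hn,
      Finset.sum_image fun x _ y _ hxy => halfWeight_injective hsys hxy]
    simp only [hheight, Fintype.sum_prod_type, Fintype.sum_bool, h, add_mul, ite_mul, one_mul,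
      zero_mul, Finset.sum_add_distrib, Finset.sum_ite_eq', Finset.mem_range]
    rw [if_pos (by omega), if_pos (by omega), if_pos (by omega), if_pos (by omega),
      if_pos (by omega)]
    ring
  · intro i hi1 hi2 hij
    simp only [h]
    split_ifs <;> omega
  · simp [h]
  · simp only [h]
    split_ifs <;> omega
  · simp only [h, one_ne_zero, if_false, zero_add]
    split_ifs <;> omega
  · simp only [h, Finset.sum_add_distrib, Finset.sum_ite_eq', Finset.mem_range]
    rw [if_pos (by omega), if_pos (by omega), if_pos (by omega), if_pos (by omega),
      if_neg (by omega)]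
    norm_num
  · simp only [h, if_true]
    omega
  · simp only [h]
    split_ifs <;> omega
end
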